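/- Fix an integer α ≥ 5, and let 𝒩_α(N) denote the number of subsets S of {1,…,N^α} with |S| = N and Σ_{i∈S} i = N(N^α+1)/2. Then, as N → ∞, 𝒩_α(N) = (√3/π) · (N^{α−1}·e)^N / N^{α+1} · (1 − 7/(30N) + 11/(2520N²) + O(1/N³)); equivalently, (π/√3)·N^{α+1}·(N^{α−1}·e)^{−N}·𝒩_α(N) − (1 − 7/(30N) + 11/(2520N²)) = O(1/N³). -/

import Mathlib

open Filter Asymptotics

/-- The number of magic series of order `N` for an `α`-dimensional hypercube: subsets
of `{1,…,N^α}` with `N` elements summing to the magic constant `N(N^α+1)/2`. -/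
def magicHypercubeSeries (α N : ℕ) : ℕ :=
  ((Finset.Icc 1 (N ^ α)).powerset.filter
    (fun S => S.card = N ∧ ∑ i ∈ S, i = N * (N ^ α + 1) / 2)).card

/-! ### Taylor bounds for `sinc` -/

lemma nonneg_of_hasDerivAt_nonneg {f f' : ℝ → ℝ} (hf : ∀ x, HasDerivAt f (f' x) x)
    (h0 : f 0 = 0) (hf' : ∀ x, 0 ≤ x → 0 ≤ f' x) {x : ℝ} (hx : 0 ≤ x) : 0 ≤ f x := by
  have hmono : MonotoneOn f (Set.Ici 0) := by
    refine monotoneOn_of_deriv_nonneg (convex_Ici 0)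
      (fun y _ => (hf y).continuousAt.continuousWithinAt)
      (fun y _ => (hf y).differentiableAt.differentiableWithinAt) ?_
    intro y hy
    rw [interior_Ici] at hy
    rw [(hf y).deriv]
    exact hf' y (le_of_lt hy)
  simpa [h0] using hmono (Set.mem_Ici.2 le_rfl) (Set.mem_Ici.2 hx) hx

lemma cos_le_taylor_four {x : ℝ} (hx : 0 ≤ x) :
    Real.cos x ≤ 1 - x ^ 2 / 2 + x ^ 4 / 24 := by
  have h := nonneg_of_hasDerivAt_nonneg
    (f := fun x => 1 - x ^ 2 / 2 + x ^ 4 / 24 - Real.cos x)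
    (f' := fun x => Real.sin x - (x - x ^ 3 / 6)) (fun x => by
      have := ((((hasDerivAt_id x).pow 2).div_const 2).const_sub 1).add
        (((hasDerivAt_id x).pow 4).div_const 24) |>.sub (Real.hasDerivAt_cos x)
      convert! this using 1
      simp; ring) (by simp) (fun x hx => by linarith [Real.sin_ge_sub_cube hx]) hx
  linarith

lemma sin_le_taylor_five {x : ℝ} (hx : 0 ≤ x) :
    Real.sin x ≤ x - x ^ 3 / 6 + x ^ 5 / 120 := by
  have h := nonneg_of_hasDerivAt_nonneg
    (f := fun x => x - x ^ 3 / 6 + x ^ 5 / 120 - Real.sin x)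
    (f' := fun x => 1 - x ^ 2 / 2 + x ^ 4 / 24 - Real.cos x) (fun x => by
      have := ((hasDerivAt_id x).sub (((hasDerivAt_id x).pow 3).div_const 6)).add
        (((hasDerivAt_id x).pow 5).div_const 120) |>.sub (Real.hasDerivAt_sin x)
      convert! this using 1
      simp; ring) (by simp) (fun x hx => by linarith [cos_le_taylor_four hx]) hx
  linarith

lemma taylor_six_le_cos {x : ℝ} (hx : 0 ≤ x) :
    1 - x ^ 2 / 2 + x ^ 4 / 24 - x ^ 6 / 720 ≤ Real.cos x := by
  have h := nonneg_of_hasDerivAt_nonneg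
    (f := fun x => Real.cos x - (1 - x ^ 2 / 2 + x ^ 4 / 24 - x ^ 6 / 720))
    (f' := fun x => x - x ^ 3 / 6 + x ^ 5 / 120 - Real.sin x) (fun x => by
      have := (Real.hasDerivAt_cos x).sub
        (((((hasDerivAt_id x).pow 2).div_const 2).const_sub 1).add
        (((hasDerivAt_id x).pow 4).div_const 24) |>.sub (((hasDerivAt_id x).pow 6).div_const 720))
      convert! this using 1
      simp; ring) (by simp) (fun x hx => by linarith [sin_le_taylor_five hx]) hx
  linarith

lemma taylor_seven_le_sin {x : ℝ} (hx : 0 ≤ x) :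
    x - x ^ 3 / 6 + x ^ 5 / 120 - x ^ 7 / 5040 ≤ Real.sin x := by
  have h := nonneg_of_hasDerivAt_nonneg
    (f := fun x => Real.sin x - (x - x ^ 3 / 6 + x ^ 5 / 120 - x ^ 7 / 5040))
    (f' := fun x => Real.cos x - (1 - x ^ 2 / 2 + x ^ 4 / 24 - x ^ 6 / 720)) (fun x => by
      have := (Real.hasDerivAt_sin x).sub
        (((hasDerivAt_id x).sub (((hasDerivAt_id x).pow 3).div_const 6)).add
        (((hasDerivAt_id x).pow 5).div_const 120) |>.sub
          (((hasDerivAt_id x).pow 7).div_const 5040))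
      convert! this using 1
      simp; ring) (by simp) (fun x hx => by linarith [taylor_six_le_cos hx]) hx
  linarith

lemma cos_le_taylor_eight {x : ℝ} (hx : 0 ≤ x) :
    Real.cos x ≤ 1 - x ^ 2 / 2 + x ^ 4 / 24 - x ^ 6 / 720 + x ^ 8 / 40320 := by
  have h := nonneg_of_hasDerivAt_nonneg
    (f := fun x => 1 - x ^ 2 / 2 + x ^ 4 / 24 - x ^ 6 / 720 + x ^ 8 / 40320 - Real.cos x)
    (f' := fun x => Real.sin x - (x - x ^ 3 / 6 + x ^ 5 / 120 - x ^ 7 / 5040)) (fun x => by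
      have := (((((hasDerivAt_id x).pow 2).div_const 2).const_sub 1).add
        (((hasDerivAt_id x).pow 4).div_const 24) |>.sub
          (((hasDerivAt_id x).pow 6).div_const 720)).add
        (((hasDerivAt_id x).pow 8).div_const 40320) |>.sub (Real.hasDerivAt_cos x)
      convert! this using 1
      simp; ring) (by simp) (fun x hx => by linarith [taylor_seven_le_sin hx]) hx
  linarith

lemma sin_le_taylor_nine {x : ℝ} (hx : 0 ≤ x) :
    Real.sin x ≤ x - x ^ 3 / 6 + x ^ 5 / 120 - x ^ 7 / 5040 + x ^ 9 / 362880 := by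
  have h := nonneg_of_hasDerivAt_nonneg
    (f := fun x => x - x ^ 3 / 6 + x ^ 5 / 120 - x ^ 7 / 5040 + x ^ 9 / 362880 - Real.sin x)
    (f' := fun x => 1 - x ^ 2 / 2 + x ^ 4 / 24 - x ^ 6 / 720 + x ^ 8 / 40320 - Real.cos x)
    (fun x => by
      have := (((hasDerivAt_id x).sub (((hasDerivAt_id x).pow 3).div_const 6)).add
        (((hasDerivAt_id x).pow 5).div_const 120) |>.sub
          (((hasDerivAt_id x).pow 7).div_const 5040)).add
        (((hasDerivAt_id x).pow 9).div_const 362880) |>.sub (Real.hasDerivAt_sin x)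
      convert! this using 1
      simp; ring) (by simp) (fun x hx => by linarith [cos_le_taylor_eight hx]) hx
  linarith

lemma sinc_abs (u : ℝ) : Real.sinc |u| = Real.sinc u := by
  rcases abs_choice u with h | h <;> rw [h]
  exact Real.sinc_neg u

lemma sinc_le_taylor_four (u : ℝ) :
    Real.sinc u ≤ 1 - u ^ 2 / 6 + u ^ 4 / 120 := by
  rcases eq_or_ne u 0 with rfl | hu
  · simp
  have hpos := abs_pos.2 hu
  rw [← sinc_abs, Real.sinc_of_ne_zero hpos.ne', div_le_iff₀ hpos]
  have := sin_le_taylor_five hpos.le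
  have h2 := sq_abs u
  have h4 : |u| ^ 4 = u ^ 4 := by rw [show (4 : ℕ) = 2 * 2 from rfl, pow_mul, h2, ← pow_mul]
  rw [← h2, ← h4]
  linarith

lemma taylor_two_le_sinc (u : ℝ) : 1 - u ^ 2 / 6 ≤ Real.sinc u := by
  rcases eq_or_ne u 0 with rfl | hu
  · simp
  have hpos := abs_pos.2 hu
  rw [← sinc_abs, Real.sinc_of_ne_zero hpos.ne', le_div_iff₀ hpos, ← sq_abs u]
  linarith [Real.sin_ge_sub_cube hpos.le]

lemma taylor_six_le_sinc (u : ℝ) :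
    1 - u ^ 2 / 6 + u ^ 4 / 120 - u ^ 6 / 5040 ≤ Real.sinc u := by
  rcases eq_or_ne u 0 with rfl | hu
  · simp
  have hpos := abs_pos.2 hu
  rw [← sinc_abs, Real.sinc_of_ne_zero hpos.ne', le_div_iff₀ hpos]
  have := taylor_seven_le_sin hpos.le
  have h2 := sq_abs u
  have h4 : |u| ^ 4 = u ^ 4 := by rw [show (4 : ℕ) = 2 * 2 from rfl, pow_mul, h2, ← pow_mul]
  have h6 : |u| ^ 6 = u ^ 6 := by rw [show (6 : ℕ) = 2 * 3 from rfl, pow_mul, h2, ← pow_mul]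
  rw [← h2, ← h4, ← h6]
  linarith

lemma sinc_le_taylor_eight (u : ℝ) :
    Real.sinc u ≤ 1 - u ^ 2 / 6 + u ^ 4 / 120 - u ^ 6 / 5040 + u ^ 8 / 362880 := by
  rcases eq_or_ne u 0 with rfl | hu
  · simp
  have hpos := abs_pos.2 hu
  rw [← sinc_abs, Real.sinc_of_ne_zero hpos.ne', div_le_iff₀ hpos]
  have := sin_le_taylor_nine hpos.le
  have h2 := sq_abs u
  have h4 : |u| ^ 4 = u ^ 4 := by rw [show (4 : ℕ) = 2 * 2 from rfl, pow_mul, h2, ← pow_mul]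
  have h6 : |u| ^ 6 = u ^ 6 := by rw [show (6 : ℕ) = 2 * 3 from rfl, pow_mul, h2, ← pow_mul]
  have h8 : |u| ^ 8 = u ^ 8 := by rw [show (8 : ℕ) = 2 * 4 from rfl, pow_mul, h2, ← pow_mul]
  rw [← h2, ← h4, ← h6, ← h8]
  linarith

lemma exp_neg_le_one_sub_add_sq {w : ℝ} (hw : 0 ≤ w) :
    Real.exp (-w) ≤ 1 - w + w ^ 2 / 2 := by
  have h := nonneg_of_hasDerivAt_nonneg
    (f := fun x => 1 - x + x ^ 2 / 2 - Real.exp (-x))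
    (f' := fun x => -1 + x + Real.exp (-x)) (fun x => by
      have := (((hasDerivAt_id x).const_sub 1).add (((hasDerivAt_id x).pow 2).div_const 2)).sub
        ((hasDerivAt_id x).neg.exp)
      convert! this using 1
      simp) (by simp)
    (fun x _ => by linarith [Real.add_one_le_exp (-x)]) hw
  linarith

lemma one_sub_add_sq_sub_cube_le_exp_neg {w : ℝ} (hw : 0 ≤ w) :
    1 - w + w ^ 2 / 2 - w ^ 3 / 6 ≤ Real.exp (-w) := by
  have h := nonneg_of_hasDerivAt_nonneg
    (f := fun x => Real.exp (-x) - (1 - x + x ^ 2 / 2 - x ^ 3 / 6))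
    (f' := fun x => 1 - x + x ^ 2 / 2 - Real.exp (-x)) (fun x => by
      have := ((hasDerivAt_id x).neg.exp).sub
        ((((hasDerivAt_id x).const_sub 1).add (((hasDerivAt_id x).pow 2).div_const 2)).sub
          (((hasDerivAt_id x).pow 3).div_const 6))
      convert! this using 1
      simp; ring) (by simp) (fun x hx => by linarith [exp_neg_le_one_sub_add_sq hx]) hw
  linarith

lemma sinc_le_exp {u : ℝ} (hu : |u| ≤ 2) : Real.sinc u ≤ Real.exp (-(u ^ 2 / 6)) := by
  have h1 := sinc_le_taylor_four u
  have h2 := one_sub_add_sq_sub_cube_le_exp_neg (w := u ^ 2 / 6) (by positivity)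
  have h3 : u ^ 2 ≤ 4 := by nlinarith [sq_abs u, abs_nonneg u]
  nlinarith [sq_nonneg (u ^ 2), mul_nonneg (sq_nonneg (u ^ 2)) (sub_nonneg.2 h3)]

lemma exp_le_sinc {v : ℝ} (hv : |v| ≤ 1) : Real.exp (-(v ^ 2 / 3)) ≤ Real.sinc v := by
  have h1 := taylor_two_le_sinc v
  have h3 : v ^ 2 ≤ 1 := by nlinarith [sq_abs v, abs_nonneg v]
  refine le_trans ?_ h1
  rw [Real.exp_neg, inv_le_comm₀ (Real.exp_pos _) (by linarith)]
  refine le_trans ?_ (Real.add_one_le_exp _)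
  rw [inv_le_comm₀ (by linarith) (by positivity), inv_le_iff_one_le_mul₀ (by positivity)]
  nlinarith [sq_nonneg v, mul_nonneg (sq_nonneg v) (sub_nonneg.2 h3)]

lemma two_div_pi_le_sinc {v : ℝ} (hv : |v| ≤ Real.pi / 2) : 2 / Real.pi ≤ Real.sinc v := by
  rcases eq_or_ne v 0 with rfl | h
  · rw [Real.sinc_zero, div_le_one Real.pi_pos]; exact Real.two_le_pi
  have hpos := abs_pos.2 h
  rw [← sinc_abs, Real.sinc_of_ne_zero hpos.ne', le_div_iff₀ hpos]
  exact Real.mul_le_sin hpos.le hv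

lemma sinc_pos_of_abs_le_two {u : ℝ} (hu : |u| ≤ 2) : 0 < Real.sinc u := by
  have := taylor_two_le_sinc u
  nlinarith [sq_abs u, abs_nonneg u]

lemma abs_log_sinc_add_le {u : ℝ} (hu : |u| ≤ 1) :
    |Real.log (Real.sinc u) + u ^ 2 / 6 + (u ^ 4 / 180 + u ^ 6 / 2835)| ≤ u ^ 8 := by
  have hl := taylor_six_le_sinc u
  have hr := sinc_le_taylor_eight u
  obtain ⟨x, hxu⟩ : ∃ x, x = u ^ 2 := ⟨_, rfl⟩
  have h4 : u ^ 4 = x ^ 2 := by rw [hxu]; ring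
  have h6 : u ^ 6 = x ^ 3 := by rw [hxu]; ring
  have h8 : u ^ 8 = x ^ 4 := by rw [hxu]; ring
  rw [h4, h6, ← hxu] at hl
  rw [h4, h6, h8, ← hxu] at hr
  rw [h4, h6, h8, ← hxu]
  have hx0 : 0 ≤ x := by rw [hxu]; positivity
  have hx1 : x ≤ 1 := by rw [hxu]; nlinarith [sq_abs u, abs_nonneg u]
  obtain ⟨y, hy⟩ : ∃ y, y = 1 - Real.sinc u := ⟨_, rfl⟩
  have hs : Real.sinc u = 1 - y := by linarith
  rw [hs] at hl hr ⊢
  obtain ⟨q, hq⟩ : ∃ q, q = x / 6 - x ^ 2 / 120 + x ^ 3 / 5040 := ⟨_, rfl⟩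
  have hx2 : x ^ 2 ≤ x := by nlinarith
  have hx3 : x ^ 3 ≤ x ^ 2 := by nlinarith [sq_nonneg x]
  have hx4 : x ^ 4 ≤ x ^ 3 := by nlinarith [pow_nonneg hx0 3]
  have hx4' : 0 ≤ x ^ 4 := by positivity
  have hx3' : 0 ≤ x ^ 3 := by positivity
  have hx2' : 0 ≤ x ^ 2 := by positivity
  have hyq : y ≤ q := by linarith
  have hqy : q - x ^ 4 / 362880 ≤ y := by linarith
  have hy0 : 0 ≤ y := by linarith
  have hq6 : q ≤ x / 6 := by linarith
  have hy6 : y ≤ x / 6 := by linarith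
  have hlog := Real.abs_log_sub_add_sum_range_le (x := y)
    (by rw [abs_of_nonneg hy0]; linarith) 3
  rw [abs_of_nonneg hy0] at hlog
  have hy4 : y ^ 4 / (1 - y) ≤ x ^ 4 / 4 := by
    rw [div_le_iff₀ (by linarith)]
    have : y ^ 4 ≤ (x / 6) ^ 4 := pow_le_pow_left₀ hy0 hy6 4
    nlinarith
  simp only [Finset.sum_range_succ, Finset.sum_range_zero] at hlog
  norm_num at hlog
  have hlog' := abs_le.1 (hlog.trans hy4)
  have hf : |(y + y ^ 2 / 2 + y ^ 3 / 3) - (q + q ^ 2 / 2 + q ^ 3 / 3)| ≤ x ^ 4 / 4 := by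
    have e : (y + y ^ 2 / 2 + y ^ 3 / 3) - (q + q ^ 2 / 2 + q ^ 3 / 3)
      = -((q - y) * (1 + (y + q) / 2 + (y ^ 2 + y * q + q ^ 2) / 3)) := by ring
    have hq0 : 0 ≤ q := by linarith
    have hb : 1 + (y + q) / 2 + (y ^ 2 + y * q + q ^ 2) / 3 ≤ 4 := by nlinarith
    have hb0 : 0 ≤ 1 + (y + q) / 2 + (y ^ 2 + y * q + q ^ 2) / 3 := by positivity
    rw [e, abs_neg, abs_of_nonneg (mul_nonneg (by linarith) hb0)]
    nlinarith
  have hf' := abs_le.1 hf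
  have hg : |(q + q ^ 2 / 2 + q ^ 3 / 3) - (x / 6 + (x ^ 2 / 180 + x ^ 3 / 2835))| ≤ x ^ 4 / 2 := by
    have e : (q + q ^ 2 / 2 + q ^ 3 / 3) - (x / 6 + (x ^ 2 / 180 + x ^ 3 / 2835))
      = x ^ 4 * (-11 / 67200 + 1 / 64800 * x ^ 1 - 23 / 31752000 * x ^ 2 +
        31 / 1524096000 * x ^ 3 - 1 / 3048192000 * x ^ 4 +
        1 / 384072192000 * x ^ 5) := by
      rw [hq]; ring
    have hp : ∀ k : ℕ, 0 ≤ x ^ k ∧ x ^ k ≤ 1 := fun k =>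
      ⟨pow_nonneg hx0 k, pow_le_one₀ hx0 hx1⟩
    rw [e, abs_mul, abs_of_nonneg hx4', div_eq_mul_one_div]
    refine mul_le_mul_of_nonneg_left ?_ hx4'
    rw [abs_le]
    constructor <;> linarith [hp 1, hp 2, hp 3, hp 4, hp 5]
  have hg' := abs_le.1 hg
  rw [abs_le]
  constructor <;> linarith

/-! ### Gaussian moments -/

lemma integrable_pow_mul_gaussian {b : ℝ} (hb : 0 < b) (k : ℕ) :
    MeasureTheory.Integrable (fun u : ℝ => u ^ k * Real.exp (-b * u ^ 2)) := by
  have h := integrable_rpow_mul_exp_neg_mul_sq hb (s := (k : ℝ))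
    (by linarith [(Nat.cast_nonneg k : (0 : ℝ) ≤ k)])
  simpa only [Real.rpow_natCast] using h

lemma integral_even_pow_mul_gaussian {b : ℝ} (hb : 0 < b) (k : ℕ) :
    ∫ u : ℝ, u ^ (2 * k) * Real.exp (-b * u ^ 2) =
      (Nat.doubleFactorial (2 * k - 1) : ℝ) / (2 * b) ^ k * √(Real.pi / b) := by
  have h1 := integral_comp_abs (f := fun u : ℝ => u ^ (2 * k) * Real.exp (-b * u ^ 2))
  simp only [pow_mul, sq_abs] at h1
  simp only [pow_mul]
  rw [h1]
  have h2 := integral_rpow_mul_exp_neg_mul_rpow (p := 2) (q := ((2 * k : ℕ) : ℝ)) (b := b)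
    (by norm_num) (by linarith [(Nat.cast_nonneg (2 * k) : (0 : ℝ) ≤ ((2 * k : ℕ) : ℝ))]) hb
  have h3 : ∫ u : ℝ in Set.Ioi 0, (u ^ 2) ^ k * Real.exp (-b * u ^ 2) =
      ∫ u : ℝ in Set.Ioi 0, u ^ ((2 * k : ℕ) : ℝ) * Real.exp (-b * u ^ (2 : ℝ)) := by
    refine MeasureTheory.setIntegral_congr_fun measurableSet_Ioi fun u _ => ?_
    simp only [Real.rpow_natCast, Real.rpow_two, pow_mul]
  rw [h3, h2]
  have e1 : (((2 * k : ℕ) : ℝ) + 1) / 2 = k + 1 / 2 := by push_cast; ring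
  have e2 : -(((2 * k : ℕ) : ℝ) + 1) / 2 = -(k : ℝ) - 1 / 2 := by push_cast; ring
  rw [e1, e2, Real.Gamma_nat_add_half, Real.rpow_sub hb, Real.rpow_neg hb.le, Real.rpow_natCast,
    ← Real.sqrt_eq_rpow, Real.sqrt_div Real.pi_pos.le]
  have := Real.sqrt_pos.2 hb
  rw [mul_pow]
  field_simp

/-! ### Pointwise bounds for the normalised Dirichlet kernel -/

/-- The Dirichlet kernel of `M` terms, normalised to be `1` at the origin and rescaled. -/
noncomputable def dirichletRatio (M u : ℝ) : ℝ := Real.sinc u / Real.sinc (u / M)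

/-- The non-Gaussian factor of the Edgeworth expansion of `sinc u ^ N`. -/
noncomputable def edgeworthFactor (N u : ℝ) : ℝ :=
  1 - N * (u ^ 4 / 180 + u ^ 6 / 2835) + N ^ 2 * u ^ 8 / 64800

/-- A majorant for the error in the Edgeworth expansion of `sinc u ^ N`. -/
noncomputable def edgeworthMajorant (N u : ℝ) : ℝ :=
  Real.exp (-(N * u ^ 2 / 12)) *
    (u ^ 2 / N ^ 2 + N * u ^ 8 + N ^ 2 * u ^ 10 + N ^ 3 * u ^ 12)

lemma abs_div_le_one {M u : ℝ} (hM : 2 ≤ M) (hu : |u| ≤ 2) : |u / M| ≤ 1 := by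
  rw [abs_div, abs_of_nonneg (by linarith : 0 ≤ M), div_le_one (by linarith)]
  linarith

lemma dirichletRatio_nonneg {M u : ℝ} (hM : 2 ≤ M) (hu : |u| ≤ 2) : 0 ≤ dirichletRatio M u :=
  div_nonneg (sinc_pos_of_abs_le_two hu).le
    (sinc_pos_of_abs_le_two ((abs_div_le_one hM hu).trans one_le_two)).le

lemma dirichletRatio_le_exp {M u : ℝ} (hM : 2 ≤ M) (hu : |u| ≤ 2) :
    dirichletRatio M u ≤ Real.exp (-(u ^ 2 / 12)) := by
  have h1 := sinc_le_exp hu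
  have h2 := exp_le_sinc (abs_div_le_one hM hu)
  unfold dirichletRatio
  rw [div_le_iff₀ (lt_of_lt_of_le (Real.exp_pos _) h2)]
  refine h1.trans (le_trans ?_ (mul_le_mul_of_nonneg_left h2 (Real.exp_pos _).le))
  rw [← Real.exp_add, Real.exp_le_exp]
  have : (u / M) ^ 2 ≤ u ^ 2 / 4 := by
    rw [div_pow]
    exact div_le_div_of_nonneg_left (sq_nonneg u) (by norm_num) (by nlinarith)
  linarith

lemma abs_dirichletRatio_le {M u : ℝ} (hM : 0 < M) (hu : u ≠ 0) (huM : |u| ≤ Real.pi * M / 2) :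
    |dirichletRatio M u| ≤ Real.pi / 2 / |u| := by
  have hv : |u / M| ≤ Real.pi / 2 := by
    rw [abs_div, abs_of_pos hM, div_le_iff₀ hM]; linarith
  have h2 := two_div_pi_le_sinc hv
  have hpos : 0 < 2 / Real.pi := by positivity
  have hu' := abs_pos.2 hu
  unfold dirichletRatio
  rw [abs_div, abs_of_pos (hpos.trans_le h2), Real.sinc_of_ne_zero hu, abs_div]
  calc |Real.sin u| / |u| / Real.sinc (u / M) ≤ 1 / |u| / (2 / Real.pi) := by
        gcongr
        exact Real.abs_sin_le_one u
    _ = Real.pi / 2 / |u| := by field_simp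

lemma abs_dirichletRatio_pow_le {M u : ℝ} {n : ℕ} (hn : 2 ≤ n) (hM : 2 ≤ M)
    (huM : |u| ≤ Real.pi * M / 2) :
    |dirichletRatio M u| ^ n ≤
      Real.exp (-(n * u ^ 2 / 12)) + (Real.pi / 4) ^ (n - 2) * (4 * (1 + u ^ 2)⁻¹) := by
  rcases le_total |u| 2 with hu | hu
  · have h1 := dirichletRatio_le_exp hM hu
    rw [abs_of_nonneg (dirichletRatio_nonneg hM hu)]
    refine (pow_le_pow_left₀ (dirichletRatio_nonneg hM hu) h1 n).trans ?_
    rw [← Real.exp_nat_mul, show (n : ℝ) * -(u ^ 2 / 12) = -(n * u ^ 2 / 12) by ring]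
    have := Real.pi_pos
    exact le_add_of_nonneg_right (by positivity)
  · have hu0 : u ≠ 0 := by
      rintro rfl
      norm_num at hu
    have h1 := abs_dirichletRatio_le (by linarith) hu0 huM
    have hpi := Real.pi_pos
    have hpi4 := Real.pi_lt_d2
    have hsq : 4 ≤ u ^ 2 := by rw [← sq_abs]; nlinarith
    have h2 : Real.pi / 2 / |u| ≤ Real.pi / 4 := by
      rw [div_le_iff₀ (by linarith)]; nlinarith
    have h3 : |dirichletRatio M u| ^ 2 ≤ 4 * (1 + u ^ 2)⁻¹ := by
      refine (pow_le_pow_left₀ (abs_nonneg _) h1 2).trans ?_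
      rw [div_pow, sq_abs, ← div_eq_mul_inv, div_le_div_iff₀ (by linarith) (by positivity)]
      have : (Real.pi / 2) ^ 2 ≤ 3 := by nlinarith
      nlinarith
    rw [← Nat.sub_add_cancel hn, pow_add, Nat.add_sub_cancel]
    refine le_add_of_nonneg_of_le (Real.exp_pos _).le ?_
    exact mul_le_mul (pow_le_pow_left₀ (abs_nonneg _) (h1.trans h2) _) h3 (by positivity)
      (by positivity)

lemma abs_exp_sub_taylor_two_le {z : ℝ} (hz : z ≤ 0) :
    |Real.exp z - (1 + z + z ^ 2 / 2)| ≤ |z| ^ 3 := by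
  have h1 := one_sub_add_sq_sub_cube_le_exp_neg (w := -z) (by linarith)
  have h2 := exp_neg_le_one_sub_add_sq (w := -z) (by linarith)
  rw [neg_neg] at h1 h2
  rw [abs_of_nonpos hz, abs_le]
  have : 0 ≤ (-z) ^ 3 := pow_nonneg (by linarith) 3
  constructor <;> nlinarith

lemma abs_gaussian_mul_edgeworthFactor_le {N u : ℝ} (hN : 1 ≤ N) (hu : 1 ≤ |u|) :
    |Real.exp (-(N * u ^ 2 / 6)) * edgeworthFactor N u| ≤ 4 * edgeworthMajorant N u := by
  have hx : 1 ≤ u ^ 2 := by rw [← sq_abs]; nlinarith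
  obtain ⟨x, hxu⟩ : ∃ x, x = u ^ 2 := ⟨_, rfl⟩
  have hN0 : 0 ≤ N := by linarith
  have hN2 : N ≤ N ^ 2 := by nlinarith
  rw [← hxu] at hx
  have hP : |edgeworthFactor N u| ≤
      4 * (u ^ 2 / N ^ 2 + N * u ^ 8 + N ^ 2 * u ^ 10 + N ^ 3 * u ^ 12) := by
    have h4 : u ^ 4 = x ^ 2 := by rw [hxu]; ring
    have h6 : u ^ 6 = x ^ 3 := by rw [hxu]; ring
    have h8 : u ^ 8 = x ^ 4 := by rw [hxu]; ring
    have h10 : u ^ 10 = x ^ 5 := by rw [hxu]; ring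
    have h12 : u ^ 12 = x ^ 6 := by rw [hxu]; ring
    unfold edgeworthFactor
    rw [h4, h6, h8, h10, h12, ← hxu]
    have a1 : 1 ≤ N * x ^ 4 := one_le_mul_of_one_le_of_one_le hN (one_le_pow₀ hx)
    have a2 : N * x ^ 2 ≤ N * x ^ 4 := by gcongr; norm_num
    have a3 : N * x ^ 3 ≤ N * x ^ 4 := by gcongr; norm_num
    have a4 : N ^ 2 * x ^ 4 ≤ N ^ 2 * x ^ 5 := by gcongr; norm_num
    have b1 : 0 ≤ N * x ^ 2 := by positivity
    have b2 : 0 ≤ N * x ^ 3 := by positivity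
    have b3 : 0 ≤ N ^ 2 * x ^ 4 := by positivity
    have b4 : 0 ≤ N ^ 3 * x ^ 6 := by positivity
    have b5 : 0 ≤ x / N ^ 2 := by positivity
    rw [abs_le]
    constructor <;> nlinarith
  unfold edgeworthMajorant
  rw [abs_mul, abs_of_pos (Real.exp_pos _), mul_left_comm]
  refine mul_le_mul ?_ hP (abs_nonneg _) (Real.exp_pos _).le
  rw [Real.exp_le_exp]
  have : 0 ≤ N * u ^ 2 := by positivity
  linarith

lemma abs_sinc_pow_sub_le {u : ℝ} (N : ℕ) (hu : |u| ≤ 1) :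
    |Real.sinc u ^ N - Real.exp (-(N * u ^ 2 / 6)) * edgeworthFactor N u| ≤
      Real.exp (-(N * u ^ 2 / 6)) *
        (N * u ^ 8 + 3 * ((N : ℝ) ^ 2 * u ^ 10) + 8 * ((N : ℝ) ^ 3 * u ^ 12)) := by
  have hs := sinc_pos_of_abs_le_two (hu.trans one_le_two)
  obtain ⟨h, hh⟩ : ∃ h, h = Real.log (Real.sinc u) + u ^ 2 / 6 := ⟨_, rfl⟩
  have hh0 : h ≤ 0 := by
    have := (Real.log_le_iff_le_exp hs).2 (sinc_le_exp (hu.trans one_le_two))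
    linarith
  have hha := abs_log_sinc_add_le hu
  rw [← hh] at hha
  have e1 : Real.sinc u ^ N = Real.exp (-(N * u ^ 2 / 6)) * Real.exp (N * h) := by
    rw [← Real.exp_add]
    nth_rewrite 1 [← Real.exp_log hs]
    rw [← Real.exp_nat_mul, hh]
    congr 1; ring
  rw [e1, ← mul_sub, abs_mul, abs_of_pos (Real.exp_pos _)]
  refine mul_le_mul_of_nonneg_left ?_ (Real.exp_pos _).le
  have hN0 : (0 : ℝ) ≤ N := Nat.cast_nonneg N
  generalize (N : ℝ) = N at *
  have hz := abs_exp_sub_taylor_two_le (z := N * h) (mul_nonpos_of_nonneg_of_nonpos hN0 hh0)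
  obtain ⟨x, hxu⟩ : ∃ x, x = u ^ 2 := ⟨_, rfl⟩
  have hx0 : 0 ≤ x := by rw [hxu]; positivity
  have hx1 : x ≤ 1 := by rw [hxu, ← sq_abs]; nlinarith [abs_nonneg u]
  have h4 : u ^ 4 = x ^ 2 := by rw [hxu]; ring
  have h6 : u ^ 6 = x ^ 3 := by rw [hxu]; ring
  have h8 : u ^ 8 = x ^ 4 := by rw [hxu]; ring
  have h10 : u ^ 10 = x ^ 5 := by rw [hxu]; ring
  have h12 : u ^ 12 = x ^ 6 := by rw [hxu]; ring
  unfold edgeworthFactor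
  rw [h4, h6, h8] at hha ⊢
  rw [h10, h12]
  have p3 : x ^ 3 ≤ x ^ 2 := pow_le_pow_of_le_one hx0 hx1 (by norm_num)
  have p4 : x ^ 4 ≤ x ^ 3 := pow_le_pow_of_le_one hx0 hx1 (by norm_num)
  have q2 : 0 ≤ x ^ 2 := by positivity
  have q3 : 0 ≤ x ^ 3 := by positivity
  have q4 : 0 ≤ x ^ 4 := by positivity
  have hha' := abs_le.1 hha
  have hlow : |h| ≤ 2 * x ^ 2 := by
    rw [abs_of_nonpos hh0]; linarith
  have hcube : |N * h| ^ 3 ≤ 8 * (N ^ 3 * x ^ 6) := by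
    rw [abs_mul, abs_of_nonneg hN0, mul_pow]
    calc N ^ 3 * |h| ^ 3 ≤ N ^ 3 * (2 * x ^ 2) ^ 3 := by gcongr
      _ = 8 * (N ^ 3 * x ^ 6) := by ring
  have hsq : |h ^ 2 - (x ^ 2 / 180) ^ 2| ≤ 6 * x ^ 5 := by
    rw [show h ^ 2 - (x ^ 2 / 180) ^ 2 = (h - x ^ 2 / 180) * (h + x ^ 2 / 180) by ring, abs_mul,
      show 6 * x ^ 5 = (3 * x ^ 2) * (2 * x ^ 3) by ring]
    have hl' := abs_le.1 hlow
    refine mul_le_mul ?_ ?_ (abs_nonneg _) (by positivity)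
    · rw [abs_le]; constructor <;> linarith
    · rw [abs_le]; constructor <;> linarith
  have hlin : |N * h + N * (x ^ 2 / 180 + x ^ 3 / 2835)| ≤ N * x ^ 4 := by
    rw [← mul_add, abs_mul, abs_of_nonneg hN0]
    exact mul_le_mul_of_nonneg_left hha hN0
  have hquad : |(N * h) ^ 2 / 2 - N ^ 2 * x ^ 4 / 64800| ≤ 3 * (N ^ 2 * x ^ 5) := by
    rw [show (N * h) ^ 2 / 2 - N ^ 2 * x ^ 4 / 64800 = N ^ 2 / 2 * (h ^ 2 - (x ^ 2 / 180) ^ 2) by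
      ring, abs_mul, abs_of_nonneg (by positivity)]
    calc N ^ 2 / 2 * |h ^ 2 - (x ^ 2 / 180) ^ 2| ≤ N ^ 2 / 2 * (6 * x ^ 5) := by gcongr
      _ = 3 * (N ^ 2 * x ^ 5) := by ring
  have z1 := abs_le.1 (hz.trans hcube)
  have z2 := abs_le.1 hlin
  have z3 := abs_le.1 hquad
  rw [abs_le]
  constructor <;> linarith

lemma abs_dirichletRatio_pow_sub_sinc_pow_le {M u : ℝ} {N : ℕ} (hN : 1 ≤ N) (hM : 2 ≤ M)
    (hNM : (N : ℝ) ^ 2 ≤ M) (hu : |u| ≤ 1) :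
    |dirichletRatio M u ^ N - Real.sinc u ^ N| ≤
      Real.exp (-(N * u ^ 2 / 6)) * (u ^ 2 / (N : ℝ) ^ 2) := by
  have hu2 := hu.trans one_le_two
  have hs := sinc_pos_of_abs_le_two hu2
  have hs1 := sinc_le_exp hu2
  have h2 := exp_le_sinc (abs_div_le_one hM hu2)
  have hv := sinc_pos_of_abs_le_two ((abs_div_le_one hM hu2).trans one_le_two)
  have hN1 : (1 : ℝ) ≤ N := by exact_mod_cast hN
  have hx1 : u ^ 2 ≤ 1 := by rw [← sq_abs]; nlinarith [abs_nonneg u]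
  have e1 : dirichletRatio M u ^ N - Real.sinc u ^ N =
      Real.sinc u ^ N * ((Real.sinc (u / M))⁻¹ ^ N - 1) := by
    unfold dirichletRatio
    rw [div_eq_mul_inv, mul_pow]; ring
  have h1 : 1 ≤ (Real.sinc (u / M))⁻¹ ^ N :=
    one_le_pow₀ ((one_le_inv₀ hv).2 (Real.sinc_le_one _))
  obtain ⟨y, hy⟩ : ∃ y, y = N * ((u / M) ^ 2 / 3) := ⟨_, rfl⟩
  have hyexp : (Real.sinc (u / M))⁻¹ ^ N ≤ Real.exp y := by
    rw [hy, Real.exp_nat_mul]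
    refine pow_le_pow_left₀ (inv_nonneg.2 hv.le) ?_ N
    rw [inv_le_comm₀ hv (Real.exp_pos _), ← Real.exp_neg]
    exact h2
  have hyle : y ≤ u ^ 2 / (N : ℝ) ^ 2 / 3 := by
    rw [hy, div_pow]
    have : (N : ℝ) * (u ^ 2 / M ^ 2) ≤ u ^ 2 / (N : ℝ) ^ 2 := by
      rw [← mul_div_assoc, div_le_div_iff₀ (by positivity) (by positivity)]
      have hM2 : ((N : ℝ) ^ 2) ^ 2 ≤ M ^ 2 := pow_le_pow_left₀ (by positivity) hNM 2
      have h34 : (N : ℝ) ^ 3 ≤ ((N : ℝ) ^ 2) ^ 2 := by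
        rw [← pow_mul]; exact pow_le_pow_right₀ hN1 (by norm_num)
      nlinarith [mul_le_mul_of_nonneg_left (h34.trans hM2) (sq_nonneg u)]
    linarith
  have hy0 : 0 ≤ y := by rw [hy]; positivity
  have hy1 : y ≤ 1 / 3 := by
    have : u ^ 2 / (N : ℝ) ^ 2 ≤ 1 := by
      rw [div_le_one (by positivity)]; nlinarith
    linarith
  have hexp : Real.exp y - 1 ≤ 3 * y := by
    have h := Real.add_one_le_exp (-y)
    rw [Real.exp_neg] at h
    have hpos := Real.exp_pos y
    have h' : (1 - y) * Real.exp y ≤ 1 := by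
      calc (1 - y) * Real.exp y ≤ (Real.exp y)⁻¹ * Real.exp y := by gcongr; linarith
        _ = 1 := inv_mul_cancel₀ hpos.ne'
    nlinarith
  rw [e1, abs_mul, abs_of_pos (pow_pos hs N), abs_of_nonneg (by linarith)]
  refine mul_le_mul ?_ (by linarith) (by linarith) (Real.exp_pos _).le
  calc Real.sinc u ^ N ≤ Real.exp (-(u ^ 2 / 6)) ^ N := pow_le_pow_left₀ hs.le hs1 N
    _ = Real.exp (-(N * u ^ 2 / 6)) := by rw [← Real.exp_nat_mul]; congr 1; ring

lemma abs_dirichletRatio_pow_sub_le {M u : ℝ} {N : ℕ} (hN : 2 ≤ N) (hM : 2 ≤ M)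
    (hNM : (N : ℝ) ^ 2 ≤ M) (huM : |u| ≤ Real.pi * M / 2) :
    |dirichletRatio M u ^ N - Real.exp (-(N * u ^ 2 / 6)) * edgeworthFactor N u| ≤
      8 * edgeworthMajorant N u + (Real.pi / 4) ^ (N - 2) * (4 * (1 + u ^ 2)⁻¹) := by
  have hpi := Real.pi_pos
  have hN1 : (1 : ℝ) ≤ N := by exact_mod_cast one_le_two.trans hN
  rcases le_total |u| 1 with hu | hu
  · have h1 := abs_sinc_pow_sub_le N hu
    have h2 := abs_dirichletRatio_pow_sub_sinc_pow_le (one_le_two.trans hN) hM hNM hu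
    have h3 := abs_sub_le (dirichletRatio M u ^ N) (Real.sinc u ^ N)
      (Real.exp (-(N * u ^ 2 / 6)) * edgeworthFactor N u)
    have h4 : 0 ≤ (Real.pi / 4) ^ (N - 2) * (4 * (1 + u ^ 2)⁻¹) := by positivity
    refine h3.trans ((add_le_add h2 h1).trans (le_add_of_le_of_nonneg ?_ h4))
    rw [← mul_add]
    unfold edgeworthMajorant
    rw [mul_left_comm 8 (Real.exp _)]
    have he : Real.exp (-(N * u ^ 2 / 6)) ≤ Real.exp (-(N * u ^ 2 / 12)) := by
      rw [Real.exp_le_exp]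
      have : 0 ≤ N * u ^ 2 := by positivity
      linarith
    refine mul_le_mul he ?_ (by positivity) (Real.exp_pos _).le
    have b1 : 0 ≤ u ^ 2 / (N : ℝ) ^ 2 := by positivity
    have b2 : 0 ≤ N * u ^ 8 := by positivity
    have b3 : 0 ≤ (N : ℝ) ^ 2 * u ^ 10 := by positivity
    linarith
  · have h1 := abs_dirichletRatio_pow_le hN hM huM
    have h2 := abs_gaussian_mul_edgeworthFactor_le hN1 hu
    have h3 := abs_sub (dirichletRatio M u ^ N)
      (Real.exp (-(N * u ^ 2 / 6)) * edgeworthFactor N u)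
    rw [abs_pow] at h3
    have h4 : Real.exp (-(N * u ^ 2 / 12)) ≤ edgeworthMajorant N u := by
      unfold edgeworthMajorant
      refine le_mul_of_one_le_right (Real.exp_pos _).le ?_
      have hx : 1 ≤ u ^ 2 := by rw [← sq_abs]; nlinarith
      have a : 1 ≤ N * u ^ 8 := by
        refine one_le_mul_of_one_le_of_one_le hN1 ?_
        rw [show u ^ 8 = (u ^ 2) ^ 4 by ring]
        exact one_le_pow₀ hx
      have b1 : 0 ≤ u ^ 2 / (N : ℝ) ^ 2 := by positivity
      have b3 : 0 ≤ (N : ℝ) ^ 2 * u ^ 10 := by positivity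
      have b4 : 0 ≤ (N : ℝ) ^ 3 * u ^ 12 := by positivity
      linarith
    have h5 := (Real.exp_pos (-(N * u ^ 2 / 12))).le.trans h4
    linarith

/-! ### Asymptotics of the kernel integral -/

lemma integrable_even_sum_mul_gaussian {b : ℝ} (hb : 0 < b) (c : ℕ → ℝ) (n : ℕ) :
    MeasureTheory.Integrable fun u : ℝ =>
      (∑ k ∈ Finset.range n, c k * u ^ (2 * k)) * Real.exp (-b * u ^ 2) := by
  simp only [Finset.sum_mul, mul_assoc]
  exact MeasureTheory.integrable_finsetSum _ fun k _ =>
    (integrable_pow_mul_gaussian hb (2 * k)).const_mul (c k)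

lemma integral_even_sum_mul_gaussian {b : ℝ} (hb : 0 < b) (c : ℕ → ℝ) (n : ℕ) :
    ∫ u : ℝ, (∑ k ∈ Finset.range n, c k * u ^ (2 * k)) * Real.exp (-b * u ^ 2) =
      (∑ k ∈ Finset.range n, c k * ((Nat.doubleFactorial (2 * k - 1) : ℝ) / (2 * b) ^ k)) *
        √(Real.pi / b) := by
  simp only [Finset.sum_mul, mul_assoc]
  rw [MeasureTheory.integral_finsetSum _ fun k _ =>
    (integrable_pow_mul_gaussian hb (2 * k)).const_mul (c k)]
  refine Finset.sum_congr rfl fun k _ => ?_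
  rw [MeasureTheory.integral_const_mul, integral_even_pow_mul_gaussian hb]

lemma edgeworthFactor_integral {N : ℝ} (hN : 0 < N) :
    MeasureTheory.Integrable (fun u => Real.exp (-(N * u ^ 2 / 6)) * edgeworthFactor N u) ∧
    ∫ u, Real.exp (-(N * u ^ 2 / 6)) * edgeworthFactor N u =
      √(6 * Real.pi / N) * (1 - 3 / (20 * N) - 13 / (1120 * N ^ 2)) := by
  let c : ℕ → ℝ := fun k => match k with
    | 0 => 1
    | 2 => -(N / 180)
    | 3 => -(N / 2835)
    | 4 => N ^ 2 / 64800
    | _ => 0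
  have hb : 0 < N / 6 := by positivity
  have e : (fun u => Real.exp (-(N * u ^ 2 / 6)) * edgeworthFactor N u) = fun u : ℝ =>
      (∑ k ∈ Finset.range 5, c k * u ^ (2 * k)) * Real.exp (-(N / 6) * u ^ 2) := by
    funext u
    simp only [Finset.sum_range_succ, Finset.sum_range_zero, c, edgeworthFactor]
    rw [show -(N * u ^ 2 / 6) = -(N / 6) * u ^ 2 by ring]
    ring
  rw [e]
  refine ⟨integrable_even_sum_mul_gaussian hb c 5, ?_⟩
  rw [integral_even_sum_mul_gaussian hb, show Real.pi / (N / 6) = 6 * Real.pi / N by field_simp,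
    mul_comm]
  congr 1
  simp only [Finset.sum_range_succ, Finset.sum_range_zero, c]
  norm_num [Nat.doubleFactorial]
  field_simp
  ring

lemma edgeworthMajorant_integral :
    ∃ C : ℝ, 0 ≤ C ∧ ∀ N : ℝ, 0 < N → MeasureTheory.Integrable (edgeworthMajorant N) ∧
      ∫ u, edgeworthMajorant N u = C / (N ^ 3 * √N) := by
  refine ⟨(6 + 105 * 6 ^ 4 + 945 * 6 ^ 5 + 10395 * 6 ^ 6) * √(12 * Real.pi), by positivity,
    fun N hN => ?_⟩
  let c : ℕ → ℝ := fun k => match k with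
    | 1 => 1 / N ^ 2
    | 4 => N
    | 5 => N ^ 2
    | 6 => N ^ 3
    | _ => 0
  have hb : 0 < N / 12 := by positivity
  have e : edgeworthMajorant N = fun u : ℝ =>
      (∑ k ∈ Finset.range 7, c k * u ^ (2 * k)) * Real.exp (-(N / 12) * u ^ 2) := by
    funext u
    simp only [Finset.sum_range_succ, Finset.sum_range_zero, c, edgeworthMajorant]
    rw [show -(N * u ^ 2 / 12) = -(N / 12) * u ^ 2 by ring]
    ring
  rw [e]
  refine ⟨integrable_even_sum_mul_gaussian hb c 7, ?_⟩
  rw [integral_even_sum_mul_gaussian hb, show Real.pi / (N / 12) = 12 * Real.pi / N by field_simp,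
    Real.sqrt_div (by positivity)]
  simp only [Finset.sum_range_succ, Finset.sum_range_zero, c]
  have := Real.sqrt_pos.2 hN
  norm_num [Nat.doubleFactorial]
  field_simp
  ring

lemma continuousOn_dirichletRatio {M : ℝ} (hM : 0 < M) :
    ContinuousOn (dirichletRatio M) (Set.Icc (-(Real.pi * M / 2)) (Real.pi * M / 2)) := by
  unfold dirichletRatio
  refine Real.continuous_sinc.continuousOn.div
    (Real.continuous_sinc.comp (continuous_id.div_const M)).continuousOn fun u hu => ?_
  have hv : |u / M| ≤ Real.pi / 2 := by
    rw [abs_div, abs_of_pos hM, div_le_iff₀ hM]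
    have := abs_le.2 hu
    linarith
  have : 0 < 2 / Real.pi := by positivity
  exact (this.trans_le (two_div_pi_le_sinc hv)).ne'

lemma integrable_tail (r : ℝ) :
    MeasureTheory.Integrable (fun u : ℝ => r * (4 * (1 + u ^ 2)⁻¹)) :=
  (integrable_inv_one_add_sq.const_mul 4).const_mul r

lemma integral_tail (r : ℝ) : ∫ u : ℝ, r * (4 * (1 + u ^ 2)⁻¹) = r * (4 * Real.pi) := by
  rw [MeasureTheory.integral_const_mul, MeasureTheory.integral_const_mul,
    integral_univ_inv_one_add_sq]

lemma exists_pi_div_four_pow_le :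
    ∃ C : ℝ, 0 ≤ C ∧ ∀ n : ℕ, 2 ≤ n → (Real.pi / 4) ^ (n - 2) ≤ C / (n : ℝ) ^ 4 := by
  have hr : |Real.pi / 4| < 1 := by
    rw [abs_of_pos (by positivity)]; linarith [Real.pi_lt_four]
  have ht := tendsto_pow_const_mul_const_pow_of_abs_lt_one 4 hr
  obtain ⟨C, hC⟩ := ht.bddAbove_range
  have hpi : 0 < Real.pi / 4 := by positivity
  have hC' : ∀ n : ℕ, (n : ℝ) ^ 4 * (Real.pi / 4) ^ n ≤ C := fun n => hC ⟨n, rfl⟩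
  have hC0 : 0 ≤ C := by simpa using hC' 0
  refine ⟨C / (Real.pi / 4) ^ 2, by positivity, fun n hn => ?_⟩
  have hn0 : (0 : ℝ) < n := by exact_mod_cast (by lia : 0 < n)
  rw [le_div_iff₀ (by positivity), le_div_iff₀ (by positivity)]
  refine le_trans (le_of_eq ?_) (hC' n)
  obtain ⟨m, rfl⟩ := Nat.exists_eq_add_of_le hn
  rw [Nat.add_sub_cancel_left, pow_add]
  ring

lemma exists_pi_div_four_pow_le_sqrt :
    ∃ C : ℝ, 0 ≤ C ∧ ∀ n : ℕ, 2 ≤ n → (Real.pi / 4) ^ (n - 2) ≤ C / ((n : ℝ) ^ 3 * √n) := by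
  obtain ⟨C, hC0, hC⟩ := exists_pi_div_four_pow_le
  refine ⟨C, hC0, fun n hn => (hC n hn).trans ?_⟩
  have hn1 : (1 : ℝ) ≤ n := by exact_mod_cast (by lia : 1 ≤ n)
  have h1 : √(n : ℝ) ≤ n := by
    rw [Real.sqrt_le_left (by linarith)]
    nlinarith
  have h2 : 0 < √(n : ℝ) := Real.sqrt_pos.2 (by linarith)
  refine div_le_div_of_nonneg_left hC0 (by positivity) ?_
  calc (n : ℝ) ^ 3 * √n ≤ (n : ℝ) ^ 3 * n := by gcongr
    _ = (n : ℝ) ^ 4 := by ring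

/-- The central kernel integral agrees with its second-order Edgeworth expansion. -/
lemma exists_abs_integral_dirichletRatio_pow_sub_le :
    ∃ C : ℝ, ∀ (N : ℕ) (M : ℝ), 2 ≤ N → (N : ℝ) ^ 2 ≤ M →
      |(∫ u in (-(Real.pi * M / 2))..(Real.pi * M / 2), dirichletRatio M u ^ N) -
        √(6 * Real.pi / N) * (1 - 3 / (20 * N) - 13 / (1120 * (N : ℝ) ^ 2))| ≤
      C / ((N : ℝ) ^ 3 * √N) := by
  obtain ⟨C₁, hC₁, hmaj⟩ := edgeworthMajorant_integral
  obtain ⟨C₂, hC₂, htail⟩ := exists_pi_div_four_pow_le_sqrt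
  refine ⟨8 * C₁ + C₂ * (4 * Real.pi), fun N M hN hNM => ?_⟩
  have hN2 : (2 : ℝ) ≤ N := by exact_mod_cast hN
  have hM : 2 ≤ M := by nlinarith
  have hpi := Real.pi_pos
  obtain ⟨hφ, hφint⟩ := edgeworthFactor_integral (N := (N : ℝ)) (by linarith)
  obtain ⟨hR, hRint⟩ := hmaj N (by linarith)
  have hle : -(Real.pi * M / 2) ≤ Real.pi * M / 2 := by
    have : 0 < Real.pi * M := by positivity
    linarith
  have hg : MeasureTheory.IntegrableOn (fun u => dirichletRatio M u ^ N)
      (Set.Ioc (-(Real.pi * M / 2)) (Real.pi * M / 2)) :=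
    ((((continuousOn_dirichletRatio (by linarith)).pow N).integrableOn_compact
      isCompact_Icc).mono_set Set.Ioc_subset_Icc_self)
  rw [intervalIntegral.integral_of_le hle, ← MeasureTheory.integral_indicator measurableSet_Ioc,
    ← hφint, ← MeasureTheory.integral_sub (hg.integrable_indicator measurableSet_Ioc) hφ]
  have hbound : ∀ u, ‖Set.indicator (Set.Ioc (-(Real.pi * M / 2)) (Real.pi * M / 2))
        (fun u => dirichletRatio M u ^ N) u -
        Real.exp (-(N * u ^ 2 / 6)) * edgeworthFactor N u‖ ≤
      8 * edgeworthMajorant N u + (Real.pi / 4) ^ (N - 2) * (4 * (1 + u ^ 2)⁻¹) := fun u => by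
    rw [Real.norm_eq_abs]
    by_cases hu : u ∈ Set.Ioc (-(Real.pi * M / 2)) (Real.pi * M / 2)
    · rw [Set.indicator_of_mem hu]
      exact abs_dirichletRatio_pow_sub_le hN hM hNM (abs_le.2 ⟨hu.1.le, hu.2⟩)
    · rw [Set.indicator_of_notMem hu, zero_sub, abs_neg]
      have hu1 : 1 ≤ |u| := by
        by_contra! h
        have h' := abs_lt.1 h
        have h3 := Real.pi_gt_three
        exact hu ⟨by nlinarith, by nlinarith⟩
      have h1 := abs_gaussian_mul_edgeworthFactor_le (N := (N : ℝ)) (by linarith) hu1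
      have h2 := (abs_nonneg _).trans h1
      have h3 : 0 ≤ (Real.pi / 4) ^ (N - 2) * (4 * (1 + u ^ 2)⁻¹) := by positivity
      linarith
  have h := MeasureTheory.norm_integral_le_of_norm_le
    ((hR.const_mul 8).add (integrable_tail ((Real.pi / 4) ^ (N - 2)))) (.of_forall hbound)
  rw [Real.norm_eq_abs] at h
  refine h.trans ?_
  simp only [Pi.add_apply]
  rw [MeasureTheory.integral_add (hR.const_mul 8) (integrable_tail _),
    MeasureTheory.integral_const_mul, hRint, integral_tail, add_div, mul_div_assoc]
  refine add_le_add le_rfl ?_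
  rw [mul_div_right_comm]
  exact mul_le_mul_of_nonneg_right (htail N hN) (by positivity)

lemma exists_integral_abs_dirichletRatio_pow_le :
    ∃ C : ℝ, 0 ≤ C ∧ ∀ (n : ℕ) (M : ℝ), 2 ≤ n → 2 ≤ M →
      ∫ u in (-(Real.pi * M / 2))..(Real.pi * M / 2), |dirichletRatio M u| ^ n ≤ C / √n := by
  obtain ⟨C₂, hC₂, htail⟩ := exists_pi_div_four_pow_le_sqrt
  refine ⟨√(12 * Real.pi) + C₂ * (4 * Real.pi), by positivity, fun n M hn hM => ?_⟩
  have hn1 : (1 : ℝ) ≤ n := by exact_mod_cast one_le_two.trans hn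
  have hpi := Real.pi_pos
  have hle : -(Real.pi * M / 2) ≤ Real.pi * M / 2 := by
    have : 0 < Real.pi * M := by positivity
    linarith
  have hb : 0 < (n : ℝ) / 12 := by positivity
  have hE : MeasureTheory.Integrable fun u : ℝ => Real.exp (-(n * u ^ 2 / 12)) := by
    convert! integrable_exp_neg_mul_sq hb using 3
    ring
  have hEint : ∫ u : ℝ, Real.exp (-(n * u ^ 2 / 12)) = √(12 * Real.pi) / √n := by
    rw [← Real.sqrt_div (by positivity), show 12 * Real.pi / n = Real.pi / ((n : ℝ) / 12) by
      field_simp, ← integral_gaussian]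
    congr 1; funext u; congr 1; ring
  have hsum := hE.add (integrable_tail ((Real.pi / 4) ^ (n - 2)))
  rw [intervalIntegral.integral_of_le hle]
  have hg : MeasureTheory.IntegrableOn (fun u => |dirichletRatio M u| ^ n)
      (Set.Ioc (-(Real.pi * M / 2)) (Real.pi * M / 2)) :=
    ((((continuousOn_dirichletRatio (by linarith)).abs.pow n).integrableOn_compact
      isCompact_Icc).mono_set Set.Ioc_subset_Icc_self)
  calc ∫ u in Set.Ioc (-(Real.pi * M / 2)) (Real.pi * M / 2), |dirichletRatio M u| ^ n
      ≤ ∫ u in Set.Ioc (-(Real.pi * M / 2)) (Real.pi * M / 2),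
          (Real.exp (-(n * u ^ 2 / 12)) + (Real.pi / 4) ^ (n - 2) * (4 * (1 + u ^ 2)⁻¹)) :=
        MeasureTheory.setIntegral_mono_on hg hsum.integrableOn measurableSet_Ioc fun u hu =>
          abs_dirichletRatio_pow_le hn hM (abs_le.2 ⟨hu.1.le, hu.2⟩)
    _ ≤ ∫ u, (Real.exp (-(n * u ^ 2 / 12)) + (Real.pi / 4) ^ (n - 2) * (4 * (1 + u ^ 2)⁻¹)) :=
        MeasureTheory.setIntegral_le_integral hsum (.of_forall fun u => by
          simp only [Pi.zero_apply]; positivity)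
    _ ≤ (√(12 * Real.pi) + C₂ * (4 * Real.pi)) / √n := by
        rw [MeasureTheory.integral_add hE (integrable_tail _), hEint, integral_tail, add_div]
        refine add_le_add le_rfl ?_
        rw [mul_div_right_comm]
        refine mul_le_mul_of_nonneg_right ((htail n hn).trans ?_) (by positivity)
        have h2 : 0 < √(n : ℝ) := Real.sqrt_pos.2 (by linarith)
        exact div_le_div_of_nonneg_left hC₂ h2
          (le_mul_of_one_le_left h2.le (one_le_pow₀ hn1))

/-! ### Counting tuples by Fourier inversion -/

/-- The tuples with entries in `{1, …, M}` and prescribed sum. -/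
def tuplesWithSum (ι : Type) [Fintype ι] [DecidableEq ι] (M s : ℕ) : Finset (ι → ℕ) :=
  (Fintype.piFinset fun _ : ι => Finset.Icc 1 M).filter fun x => ∑ i, x i = s

lemma integral_exp_int_mul (k : ℤ) :
    ∫ θ in (-Real.pi)..Real.pi, Complex.exp (k * θ * Complex.I) =
      if k = 0 then 2 * (Real.pi : ℂ) else 0 := by
  split_ifs with h
  · subst h
    simp [two_mul]
  · have hc : (k * Complex.I : ℂ) ≠ 0 := by simp [h]
    have := integral_exp_mul_complex (a := -Real.pi) (b := Real.pi) hc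
    simp only [mul_right_comm _ Complex.I] at this
    rw [this, div_eq_zero_iff]
    left
    rw [sub_eq_zero, Complex.exp_eq_exp_iff_exists_int]
    refine ⟨k, ?_⟩
    push_cast
    ring

/-- The centred Dirichlet kernel, written with complex exponentials. -/
noncomputable def centredDirichletKernel (M : ℕ) (θ : ℝ) : ℂ :=
  ∑ j ∈ Finset.Icc 1 M, Complex.exp (((j : ℂ) - (M + 1) / 2) * θ * Complex.I)

lemma centredDirichletKernel_mul_sin (M : ℕ) (θ : ℝ) :
    centredDirichletKernel M θ * Complex.sin (θ / 2) = Complex.sin (M * θ / 2) := by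
  have h2 : (2 * Complex.I : ℂ) ≠ 0 := by simp
  apply mul_right_cancel₀ h2
  have hs : ∀ z : ℂ, Complex.sin z * (2 * Complex.I) =
      Complex.exp (z * Complex.I) - Complex.exp (-z * Complex.I) := fun z => by
    rw [Complex.sin]
    linear_combination (Complex.exp (-z * Complex.I) - Complex.exp (z * Complex.I)) *
      Complex.I_mul_I
  rw [mul_assoc, hs, hs, centredDirichletKernel, Finset.sum_mul]
  have hterm : ∀ j ∈ Finset.Icc 1 M,
      Complex.exp (((j : ℂ) - (M + 1) / 2) * θ * Complex.I) *
        (Complex.exp ((θ : ℂ) / 2 * Complex.I) - Complex.exp (-((θ : ℂ) / 2) * Complex.I)) =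
      Complex.exp (((j : ℂ) - M / 2) * θ * Complex.I) -
        Complex.exp ((((j - 1 : ℕ) : ℂ) - M / 2) * θ * Complex.I) := fun j hj => by
    have hj1 := (Finset.mem_Icc.1 hj).1
    rw [mul_sub, ← Complex.exp_add, ← Complex.exp_add, Nat.cast_sub hj1]
    congr 2 <;> push_cast <;> ring
  rw [Finset.sum_congr rfl hterm]
  have htel : ∀ n : ℕ, ∑ j ∈ Finset.Icc 1 n, (Complex.exp (((j : ℂ) - M / 2) * θ * Complex.I) -
        Complex.exp ((((j - 1 : ℕ) : ℂ) - M / 2) * θ * Complex.I)) =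
      Complex.exp (((n : ℂ) - M / 2) * θ * Complex.I) -
        Complex.exp ((-(M : ℂ) / 2) * θ * Complex.I) := fun n => by
    induction n with
    | zero => simp [neg_div]
    | succ n ih =>
      rw [Finset.sum_Icc_succ_top (by lia), ih]
      simp
  rw [htel]
  congr 2 <;> ring

lemma sum_exp_eq_centredDirichletKernel (M : ℕ) (θ : ℝ) :
    ∑ j ∈ Finset.Icc 1 M, Complex.exp (j * θ * Complex.I) =
      Complex.exp ((M + 1) / 2 * θ * Complex.I) * centredDirichletKernel M θ := by
  rw [centredDirichletKernel, Finset.mul_sum]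
  refine Finset.sum_congr rfl fun j _ => ?_
  rw [← Complex.exp_add]
  congr 1; ring

lemma two_pi_mul_card_tuplesWithSum (ι : Type) [Fintype ι] [DecidableEq ι] (M s : ℕ) :
    (2 * Real.pi * (tuplesWithSum ι M s).card : ℂ) =
      ∫ θ in (-Real.pi)..Real.pi,
        Complex.exp ((Fintype.card ι * (M + 1) / 2 - s) * θ * Complex.I) *
          centredDirichletKernel M θ ^ Fintype.card ι := by
  have key : ∀ θ : ℝ, Complex.exp ((Fintype.card ι * (M + 1) / 2 - s) * θ * Complex.I) *
          centredDirichletKernel M θ ^ Fintype.card ι =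
      ∑ x ∈ Fintype.piFinset fun _ : ι => Finset.Icc 1 M,
        Complex.exp (((∑ i, (x i : ℤ) - s : ℤ) : ℂ) * θ * Complex.I) := fun θ => by
    have h1 : Complex.exp ((Fintype.card ι * (M + 1) / 2 - s) * θ * Complex.I) =
        Complex.exp (-(s : ℂ) * θ * Complex.I) *
          Complex.exp ((M + 1) / 2 * θ * Complex.I) ^ Fintype.card ι := by
      rw [← Complex.exp_nat_mul, ← Complex.exp_add]
      congr 1; ring
    rw [h1, mul_assoc, ← mul_pow, ← sum_exp_eq_centredDirichletKernel, ← Finset.card_univ,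
      ← Finset.prod_const, Finset.prod_univ_sum, Finset.mul_sum]
    refine Finset.sum_congr rfl fun x _ => ?_
    rw [← Complex.exp_sum, ← Complex.exp_add]
    congr 1
    push_cast
    rw [← Finset.sum_mul, ← Finset.sum_mul]
    ring
  simp only [key]
  rw [intervalIntegral.integral_finsetSum fun x _ =>
    Continuous.intervalIntegrable (by fun_prop) _ _]
  simp only [integral_exp_int_mul]
  rw [← Finset.sum_filter, Finset.sum_const, nsmul_eq_mul, mul_comm, tuplesWithSum]
  congr 3
  refine Finset.filter_congr fun x _ => ?_
  rw [sub_eq_zero]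
  exact_mod_cast Iff.rfl

lemma centredDirichletKernel_two_mul_div {M : ℕ} (hM : 0 < M) {u : ℝ} (hu : u ≠ 0)
    (huM : |u| ≤ Real.pi * M / 2) :
    centredDirichletKernel M (2 / M * u) = ((M * dirichletRatio M u : ℝ) : ℂ) := by
  have hM0 : (0 : ℝ) < M := by exact_mod_cast hM
  have hv : |u / M| ≤ Real.pi / 2 := by
    rw [abs_div, abs_of_pos hM0, div_le_iff₀ hM0]; linarith
  have hv0 : u / M ≠ 0 := div_ne_zero hu hM0.ne'
  have hpi : 0 < 2 / Real.pi := by positivity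
  have hsinc := (hpi.trans_le (two_div_pi_le_sinc hv)).ne'
  have hsin : Real.sin (u / M) ≠ 0 := by
    rw [Real.sinc_of_ne_zero hv0] at hsinc
    exact fun h => hsinc (by rw [h, zero_div])
  have h := centredDirichletKernel_mul_sin M (2 / M * u)
  have e1 : (((2 / M * u : ℝ) : ℂ) / 2) = ((u / M : ℝ) : ℂ) := by push_cast; ring
  have hMC : (M : ℂ) ≠ 0 := by exact_mod_cast hM.ne'
  have e2 : (M * ((2 / M * u : ℝ) : ℂ) / 2) = (u : ℂ) := by push_cast; field_simp
  rw [e1, e2, ← Complex.ofReal_sin, ← Complex.ofReal_sin] at h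
  have hsinC : ((Real.sin (u / M) : ℝ) : ℂ) ≠ 0 := by exact_mod_cast hsin
  rw [eq_div_of_mul_eq hsinC h, ← Complex.ofReal_div]
  congr 1
  unfold dirichletRatio
  rw [Real.sinc_of_ne_zero hu, Real.sinc_of_ne_zero hv0]
  field_simp

lemma integral_rescale {M : ℕ} (hM : 0 < M) {E : Type} [NormedAddCommGroup E] [NormedSpace ℝ E]
    (f : ℝ → E) :
    ∫ θ in (-Real.pi)..Real.pi, f θ =
      (2 / M : ℝ) • ∫ u in (-(Real.pi * M / 2))..(Real.pi * M / 2), f (2 / M * u) := by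
  have hM0 : (0 : ℝ) < M := by exact_mod_cast hM
  have h2 : (2 / M : ℝ) ≠ 0 := by positivity
  rw [intervalIntegral.integral_comp_mul_left f h2, smul_smul, mul_inv_cancel₀ h2, one_smul]
  congr 1 <;> field_simp

lemma ae_interval_of_forall {a : ℝ} (ha : 0 ≤ a) {p : ℝ → Prop}
    (h : ∀ u, u ≠ 0 → |u| ≤ a → p u) :
    ∀ᵐ u, u ∈ Set.uIoc (-a) a → p u := by
  filter_upwards [MeasureTheory.Measure.ae_ne MeasureTheory.volume (0 : ℝ)] with u hu hmem
  rw [Set.uIoc_of_le (by linarith)] at hmem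
  exact h u hu (abs_le.2 ⟨hmem.1.le, hmem.2⟩)

/-- The number of tuples with the central sum, as an integral. -/
lemma card_tuplesWithSum_eq (ι : Type) [Fintype ι] [DecidableEq ι] {M s : ℕ} (hM : 0 < M)
    (hs : 2 * s = Fintype.card ι * (M + 1)) :
    Real.pi * (tuplesWithSum ι M s).card * M =
      (M : ℝ) ^ Fintype.card ι *
        ∫ u in (-(Real.pi * M / 2))..(Real.pi * M / 2), dirichletRatio M u ^ Fintype.card ι := by
  have hM0 : (0 : ℝ) < M := by exact_mod_cast hM
  have h := two_pi_mul_card_tuplesWithSum ι M s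
  have hs' : (Fintype.card ι * (M + 1) / 2 - s : ℂ) = 0 := by
    have : (2 * s : ℂ) = Fintype.card ι * (M + 1) := by exact_mod_cast hs
    rw [← this]; ring
  simp only [hs', zero_mul, Complex.exp_zero, one_mul] at h
  rw [integral_rescale hM] at h
  have hcongr : ∫ u in (-(Real.pi * M / 2))..(Real.pi * M / 2),
        centredDirichletKernel M (2 / M * u) ^ Fintype.card ι =
      ∫ u in (-(Real.pi * M / 2))..(Real.pi * M / 2),
        (((M : ℝ) ^ Fintype.card ι * dirichletRatio M u ^ Fintype.card ι : ℝ) : ℂ) := by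
    refine intervalIntegral.integral_congr_ae
      (ae_interval_of_forall (by positivity) fun u hu huM => ?_)
    rw [centredDirichletKernel_two_mul_div hM hu huM, ← mul_pow, Complex.ofReal_pow]
  rw [hcongr, intervalIntegral.integral_ofReal, intervalIntegral.integral_const_mul,
    Complex.real_smul] at h
  have h' : 2 * Real.pi * (tuplesWithSum ι M s).card = 2 / M * ((M : ℝ) ^ Fintype.card ι *
      ∫ u in (-(Real.pi * M / 2))..(Real.pi * M / 2), dirichletRatio M u ^ Fintype.card ι) := by
    exact_mod_cast h
  field_simp at h'
  linarith

lemma card_tuplesWithSum_le (ι : Type) [Fintype ι] [DecidableEq ι] {M : ℕ} (hM : 0 < M) (s : ℕ) :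
    Real.pi * (tuplesWithSum ι M s).card * M ≤
      (M : ℝ) ^ Fintype.card ι *
        ∫ u in (-(Real.pi * M / 2))..(Real.pi * M / 2),
          |dirichletRatio M u| ^ Fintype.card ι := by
  have hM0 : (0 : ℝ) < M := by exact_mod_cast hM
  have h := congrArg norm (two_pi_mul_card_tuplesWithSum ι M s)
  have hle : -(Real.pi * M / 2) ≤ Real.pi * M / 2 := by
    have : 0 < Real.pi * M := by positivity
    linarith
  rw [integral_rescale hM, norm_smul] at h
  have hnorm := intervalIntegral.norm_integral_le_integral_norm (μ := MeasureTheory.volume)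
    (f := fun u : ℝ => Complex.exp ((Fintype.card ι * (M + 1) / 2 - s) * ((2 / M * u : ℝ) : ℂ) *
      Complex.I) * centredDirichletKernel M (2 / M * u) ^ Fintype.card ι) hle
  have hcongr : ∫ u in (-(Real.pi * M / 2))..(Real.pi * M / 2),
        ‖Complex.exp ((Fintype.card ι * (M + 1) / 2 - s) * ((2 / M * u : ℝ) : ℂ) *
          Complex.I) * centredDirichletKernel M (2 / M * u) ^ Fintype.card ι‖ =
      ∫ u in (-(Real.pi * M / 2))..(Real.pi * M / 2),
        (M : ℝ) ^ Fintype.card ι * |dirichletRatio M u| ^ Fintype.card ι := by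
    refine intervalIntegral.integral_congr_ae
      (ae_interval_of_forall (by positivity) fun u hu huM => ?_)
    rw [centredDirichletKernel_two_mul_div hM hu huM, norm_mul, norm_pow, Complex.norm_real,
      Real.norm_eq_abs, abs_mul, abs_of_pos hM0, mul_pow]
    have : (Fintype.card ι * (M + 1) / 2 - s : ℂ) * ((2 / M * u : ℝ) : ℂ) * Complex.I =
      (((Fintype.card ι * (M + 1) / 2 - s) * (2 / M * u) : ℝ) : ℂ) * Complex.I := by
        push_cast; ring
    rw [this, Complex.norm_exp_ofReal_mul_I, one_mul]
  rw [hcongr, intervalIntegral.integral_const_mul] at hnorm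
  have hl : ‖(2 * Real.pi * (tuplesWithSum ι M s).card : ℂ)‖ =
      2 * Real.pi * (tuplesWithSum ι M s).card := by
    rw [← Complex.ofReal_natCast, ← Complex.ofReal_ofNat, ← Complex.ofReal_mul,
      ← Complex.ofReal_mul, Complex.norm_real, Real.norm_of_nonneg (by positivity)]
  rw [hl, Real.norm_of_nonneg (by positivity)] at h
  have h' := h.le.trans (mul_le_mul_of_nonneg_left hnorm (by positivity : (0 : ℝ) ≤ 2 / M))
  rw [div_mul_eq_mul_div, le_div_iff₀ hM0] at h'
  linarith

/-! ### From tuples to sets -/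

lemma card_injective_tuplesWithSum (N M s : ℕ) :
    ((tuplesWithSum (Fin N) M s).filter Function.Injective).card =
      N.factorial * ((Finset.Icc 1 M).powerset.filter
        (fun S => S.card = N ∧ ∑ i ∈ S, i = s)).card := by
  rw [Finset.card_eq_sum_card_fiberwise (f := fun x => Finset.univ.image x)
    (t := (Finset.Icc 1 M).powerset.filter (fun S => S.card = N ∧ ∑ i ∈ S, i = s)),
    Finset.sum_const_nat (m := N.factorial), mul_comm]
  · intro S hS
    obtain ⟨hSM, hcard, hsum⟩ : S ⊆ Finset.Icc 1 M ∧ S.card = N ∧ ∑ i ∈ S, i = s := by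
      simpa using hS
    have hemb : (Finset.univ : Finset (Fin N ↪ S)).card = N.factorial := by
      rw [Finset.card_univ, Fintype.card_embedding_eq, Fintype.card_coe, hcard,
        Fintype.card_fin, Nat.descFactorial_self]
    rw [← hemb]
    symm
    refine Finset.card_bij (fun e _ k => (e k : ℕ)) ?_ ?_ ?_
    · intro e _
      have hinj : Function.Injective fun k => (e k : ℕ) :=
        Subtype.val_injective.comp e.injective
      have himg : Finset.univ.image (fun k => (e k : ℕ)) = S := by
        refine Finset.eq_of_subset_of_card_le ?_ ?_
        · intro a ha
          obtain ⟨k, -, rfl⟩ := Finset.mem_image.mp ha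
          exact (e k).2
        · rw [Finset.card_image_of_injective _ hinj, hcard, Finset.card_univ, Fintype.card_fin]
      refine Finset.mem_filter.mpr ⟨Finset.mem_filter.mpr ⟨Finset.mem_filter.mpr ⟨?_, ?_⟩, hinj⟩,
        himg⟩
      · exact Fintype.mem_piFinset.mpr fun k => hSM (e k).2
      · have h := Finset.sum_image (f := id) (s := Finset.univ) (g := fun k => (e k : ℕ))
          fun a _ b _ h => hinj h
        rw [himg] at h
        exact h.symm.trans hsum
    · intro e _ e' _ h
      ext k
      exact congrFun h k
    · intro x hx
      obtain ⟨hx, himg⟩ := Finset.mem_filter.mp hx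
      have hinj := (Finset.mem_filter.mp hx).2
      exact ⟨⟨fun k => ⟨x k, himg ▸ Finset.mem_image_of_mem x (Finset.mem_univ k)⟩,
        fun a b h => hinj (congrArg Subtype.val h)⟩, Finset.mem_univ _, rfl⟩
  · intro x hx
    obtain ⟨hx, hinj⟩ := Finset.mem_filter.mp hx
    obtain ⟨hxM, hsum⟩ := Finset.mem_filter.mp hx
    rw [Fintype.mem_piFinset] at hxM
    refine Finset.mem_filter.mpr ⟨Finset.mem_powerset.mpr ?_, ?_, ?_⟩
    · intro a ha
      obtain ⟨k, -, rfl⟩ := Finset.mem_image.mp ha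
      exact hxM k
    · rw [Finset.card_image_of_injective _ hinj, Finset.card_univ, Fintype.card_fin]
    · rw [Finset.sum_image fun a _ b _ h => hinj h, hsum]

lemma card_tuplesWithSum_filter_eq_le {ι : Type} [Fintype ι] [DecidableEq ι] (M s : ℕ)
    {i j : ι} (hij : i ≠ j) :
    ((tuplesWithSum ι M s).filter fun x => x i = x j).card ≤
      ∑ v ∈ Finset.Icc 1 M, (tuplesWithSum {k // k ≠ i ∧ k ≠ j} M (s - 2 * v)).card := by
  rw [Finset.card_eq_sum_card_fiberwise (f := fun x => x i) (t := Finset.Icc 1 M)]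
  · refine Finset.sum_le_sum fun v _ => ?_
    have hsplit : ∀ x : ι → ℕ,
        ∑ k, x k = x i + x j + ∑ k : {k // k ≠ i ∧ k ≠ j}, x k := by
      intro x
      rw [← Finset.sum_subtype (Finset.univ \ {i, j}) (by simp) x,
        ← Finset.sum_sdiff (Finset.subset_univ {i, j}), Finset.sum_pair hij, add_comm]
    refine Finset.card_le_card_of_injOn (fun x k => x k) ?_ ?_
    · intro x hx
      obtain ⟨⟨⟨hxM, hsum⟩, hxij⟩, hxi⟩ : (((∀ k, x k ∈ Finset.Icc 1 M) ∧ ∑ k, x k = s) ∧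
          x i = x j) ∧ x i = v := by
        simpa only [tuplesWithSum, Finset.coe_filter, Finset.mem_filter, Set.mem_ofPred_eq,
          Fintype.mem_piFinset] using hx
      refine Finset.mem_filter.mpr ⟨Fintype.mem_piFinset.mpr fun k => hxM k, ?_⟩
      change ∑ k : {k // k ≠ i ∧ k ≠ j}, x k = _
      have := hsplit x
      omega
    · intro x hx y hy hxy
      obtain ⟨hx, hxv⟩ := Finset.mem_filter.mp hx
      obtain ⟨hy, hyv⟩ := Finset.mem_filter.mp hy
      have hxij := (Finset.mem_filter.mp hx).2
      have hyij := (Finset.mem_filter.mp hy).2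
      funext k
      by_cases hki : k = i
      · subst hki
        rw [hxv, hyv]
      by_cases hkj : k = j
      · subst hkj
        rw [← hxij, ← hyij, hxv, hyv]
      exact congrFun hxy ⟨k, hki, hkj⟩
  · intro x hx
    have hx := (Finset.mem_filter.mp hx).1
    exact Fintype.mem_piFinset.mp (Finset.mem_filter.mp hx).1 i

lemma card_not_injective_tuplesWithSum_le {N M s B : ℕ}
    (hB : ∀ i j : Fin N, i ≠ j → ∀ t, (tuplesWithSum {k // k ≠ i ∧ k ≠ j} M t).card ≤ B) :
    ((tuplesWithSum (Fin N) M s).filter fun x => ¬ Function.Injective x).card ≤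
      N ^ 2 * (M * B) := by
  have hsub : ((tuplesWithSum (Fin N) M s).filter fun x => ¬ Function.Injective x) ⊆
      (Finset.univ : Finset (Fin N)).offDiag.biUnion fun p =>
        (tuplesWithSum (Fin N) M s).filter fun x => x p.1 = x p.2 := by
    intro x hx
    obtain ⟨hx, hinj⟩ := Finset.mem_filter.mp hx
    obtain ⟨a, b, hab, hne⟩ := Function.not_injective_iff.mp hinj
    exact Finset.mem_biUnion.mpr ⟨(a, b), by simpa using hne, Finset.mem_filter.mpr ⟨hx, hab⟩⟩
  refine (Finset.card_le_card hsub).trans <| Finset.card_biUnion_le.trans ?_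
  calc _ ≤ ∑ _p ∈ (Finset.univ : Finset (Fin N)).offDiag, M * B := by
        refine Finset.sum_le_sum fun p hp => ?_
        have hne : p.1 ≠ p.2 := by simpa using hp
        refine (card_tuplesWithSum_filter_eq_le M s hne).trans ?_
        refine (Finset.sum_le_card_nsmul _ _ B fun v _ => hB _ _ hne _).trans ?_
        simp
    _ = (Finset.univ : Finset (Fin N)).offDiag.card * (M * B) := by simp
    _ ≤ N ^ 2 * (M * B) := by
        refine Nat.mul_le_mul_right _ ?_
        rw [Finset.offDiag_card, Finset.card_univ, Fintype.card_fin, sq]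
        exact Nat.sub_le _ _

/-- The number of magic series, compared with the central Fourier integral. -/
lemma exists_abs_magicHypercubeSeries_sub_le : ∃ C : ℝ, 0 ≤ C ∧ ∀ α N : ℕ, 1 ≤ α → 4 ≤ N →
    |Real.pi * (N.factorial * magicHypercubeSeries α N) * ((N ^ α : ℕ) : ℝ) -
      ((N ^ α : ℕ) : ℝ) ^ N * ∫ u in (-(Real.pi * ((N ^ α : ℕ) : ℝ) / 2))..
        (Real.pi * ((N ^ α : ℕ) : ℝ) / 2), dirichletRatio ((N ^ α : ℕ) : ℝ) u ^ N| ≤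
      C * N ^ 2 * ((N ^ α : ℕ) : ℝ) ^ (N - 1) / √((N - 2 : ℕ) : ℝ) := by
  obtain ⟨C, hC0, hC⟩ := exists_integral_abs_dirichletRatio_pow_le
  refine ⟨C, hC0, fun α N hα hN => ?_⟩
  have hMN : N ≤ N ^ α := Nat.le_self_pow (by omega) N
  obtain ⟨s, hs⟩ : ∃ s, s = N * (N ^ α + 1) / 2 := ⟨_, rfl⟩
  have hs2 : 2 * s = Fintype.card (Fin N) * (N ^ α + 1) := by
    rw [hs, Fintype.card_fin]
    refine Nat.mul_div_cancel' ?_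
    rcases Nat.even_or_odd N with h | h
    · exact h.two_dvd.mul_right _
    · exact ((h.pow).add_one).two_dvd.mul_left _
  have hcount : N.factorial * magicHypercubeSeries α N =
      ((tuplesWithSum (Fin N) (N ^ α) s).filter Function.Injective).card := by
    rw [card_injective_tuplesWithSum, magicHypercubeSeries, hs]
  generalize N ^ α = M at *
  have hM : 0 < M := by omega
  have hMR : (0 : ℝ) < M := by exact_mod_cast hM
  have hmain := card_tuplesWithSum_eq (Fin N) hM hs2
  rw [Fintype.card_fin] at hmain
  rw [← Finset.card_filter_add_card_filter_not Function.Injective, ← hcount] at hmain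
  rw [← hmain]
  push_cast
  obtain ⟨B, hBdef⟩ : ∃ B : ℕ, B =
      ⌊(M : ℝ) ^ (N - 2) * (C / √((N - 2 : ℕ) : ℝ)) / (Real.pi * M)⌋₊ := ⟨_, rfl⟩
  have hB : ∀ i j : Fin N, i ≠ j → ∀ t,
      (tuplesWithSum {k // k ≠ i ∧ k ≠ j} M t).card ≤ B := by
    intro i j hij t
    have hcard : Fintype.card {k // k ≠ i ∧ k ≠ j} = N - 2 := by
      rw [Fintype.card_subtype]
      have : (Finset.univ.filter fun k => k ≠ i ∧ k ≠ j) = Finset.univ \ {i, j} := by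
        ext k
        simp
      rw [this, Finset.card_sdiff_of_subset (Finset.subset_univ _), Finset.card_pair hij,
        Finset.card_univ, Fintype.card_fin]
    have h := card_tuplesWithSum_le {k // k ≠ i ∧ k ≠ j} hM t
    rw [hcard] at h
    have h' := hC (N - 2) M (by omega) (by exact_mod_cast (by omega : 2 ≤ M))
    rw [hBdef]
    refine Nat.le_floor ((le_div_iff₀ (by positivity)).mpr ?_)
    calc _ = Real.pi * ((tuplesWithSum {k // k ≠ i ∧ k ≠ j} M t).card : ℝ) * M := by ring
      _ ≤ _ := h.trans (mul_le_mul_of_nonneg_left h' (by positivity))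
  have hB' : (B : ℝ) ≤ (M : ℝ) ^ (N - 2) * (C / √((N - 2 : ℕ) : ℝ)) / (Real.pi * M) := by
    rw [hBdef]
    exact Nat.floor_le (by positivity)
  have hbad : (((tuplesWithSum (Fin N) M s).filter fun x => ¬ Function.Injective x).card : ℝ) ≤
      (N : ℝ) ^ 2 * (M * B) := by
    exact_mod_cast card_not_injective_tuplesWithSum_le hB
  obtain ⟨m, rfl⟩ : ∃ m, N = m + 2 := ⟨N - 2, by omega⟩
  simp only [Nat.add_sub_cancel, show m + 2 - 1 = m + 1 by omega] at hB' ⊢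
  rw [show ∀ a b c : ℝ, Real.pi * a * c - Real.pi * (a + b) * c = -(Real.pi * b * c) by
    intros; ring, abs_neg, abs_of_nonneg (by positivity)]
  calc _ ≤ Real.pi * (((m + 2 : ℕ) : ℝ) ^ 2 *
        (M * ((M : ℝ) ^ m * (C / √(m : ℝ)) / (Real.pi * M)))) * M := by
          gcongr
          exact hbad.trans (by gcongr)
    _ = _ := by
      push_cast
      field_simp
      ring

/-! ### Second-order Stirling expansion -/

lemma log_stirlingSeq_le {n : ℕ} (hn : n ≠ 0) :
    Real.log (Stirling.stirlingSeq n) ≤ Real.log √Real.pi + 1 / (12 * n) := by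
  obtain ⟨m, rfl⟩ := Nat.exists_eq_succ_of_ne_zero hn
  have hmono : Monotone fun k : ℕ =>
      Real.log (Stirling.stirlingSeq (k + 1)) - 1 / (12 * ((k : ℝ) + 1)) := by
    refine monotone_nat_of_le_succ fun k => ?_
    have h := Stirling.log_stirlingSeq_sdiff_le (k + 1)
    have hk : (0 : ℝ) ≤ k := k.cast_nonneg
    have he : 1 / (12 * ((k : ℝ) + 1)) - 1 / (12 * ((k : ℝ) + 1 + 1)) =
        1 / (12 * ((k : ℝ) + 1) * (k + 1 + 1)) := by
      field_simp
      ring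
    push_cast at h ⊢
    rw [show (k : ℝ) + 1 + 1 = k + 2 by ring] at *
    linarith
  have hlim : Tendsto (fun k : ℕ =>
      Real.log (Stirling.stirlingSeq (k + 1)) - 1 / (12 * ((k : ℝ) + 1))) atTop
      (nhds (Real.log √Real.pi - 0)) := by
    refine Tendsto.sub ?_ ?_
    · refine Tendsto.log ?_ (by positivity)
      exact Stirling.tendsto_stirlingSeq_sqrt_pi.comp (tendsto_add_atTop_nat 1)
    · simpa [mul_comm] using
        (tendsto_one_div_add_atTop_nhds_zero_nat (𝕜 := ℝ)).const_mul 12⁻¹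
  have := hmono.ge_of_tendsto hlim m
  push_cast
  simp only [sub_zero, Nat.succ_eq_add_one] at this ⊢
  linarith

lemma le_log_stirlingSeq {n : ℕ} (hn : n ≠ 0) :
    Real.log √Real.pi + 1 / (12 * n) - 1 / (144 * (n : ℝ) ^ 3) ≤
      Real.log (Stirling.stirlingSeq n) := by
  obtain ⟨m, rfl⟩ := Nat.exists_eq_succ_of_ne_zero hn
  have hanti : Antitone fun k : ℕ => Real.log (Stirling.stirlingSeq (k + 1)) -
      1 / (12 * ((k : ℝ) + 1)) + 1 / (144 * ((k : ℝ) + 1) ^ 3) := by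
    refine antitone_nat_of_succ_le fun k => ?_
    have h := sum_le_hasSum {0} (fun i _ => by positivity)
      (Stirling.log_stirlingSeq_sdiff_hasSum k)
    have hk : (0 : ℝ) ≤ k := k.cast_nonneg
    have he : 1 / (12 * ((k : ℝ) + 1)) - 1 / (12 * ((k : ℝ) + 1 + 1)) -
        (1 / (144 * ((k : ℝ) + 1) ^ 3) - 1 / (144 * ((k : ℝ) + 1 + 1) ^ 3)) ≤
        1 / 3 * (1 / (2 * ((k : ℝ) + 1) + 1)) ^ 2 := by
      rw [← sub_nonneg]
      have : 1 / 3 * (1 / (2 * ((k : ℝ) + 1) + 1)) ^ 2 -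
          (1 / (12 * ((k : ℝ) + 1)) - 1 / (12 * ((k : ℝ) + 1 + 1)) -
          (1 / (144 * ((k : ℝ) + 1) ^ 3) - 1 / (144 * ((k : ℝ) + 1 + 1) ^ 3))) =
          (7 * ((k : ℝ) + 1) * (k + 2) + 1) /
          (144 * (2 * ((k : ℝ) + 1) + 1) ^ 2 * (k + 1) ^ 3 * (k + 1 + 1) ^ 3) := by
        field_simp
        ring
      rw [this]
      positivity
    norm_num at h
    norm_num at he
    push_cast
    norm_num
    linarith
  have hlim : Tendsto (fun k : ℕ => Real.log (Stirling.stirlingSeq (k + 1)) -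
      1 / (12 * ((k : ℝ) + 1)) + 1 / (144 * ((k : ℝ) + 1) ^ 3)) atTop
      (nhds (Real.log √Real.pi - 0 + 0)) := by
    have h0 := tendsto_one_div_add_atTop_nhds_zero_nat (𝕜 := ℝ)
    refine (Tendsto.sub ?_ ?_).add ?_
    · refine Tendsto.log ?_ (by positivity)
      exact Stirling.tendsto_stirlingSeq_sqrt_pi.comp (tendsto_add_atTop_nat 1)
    · simpa [mul_comm] using h0.const_mul 12⁻¹
    · simpa [mul_comm] using (h0.pow 3).const_mul 144⁻¹
  have := hanti.le_of_tendsto hlim m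
  push_cast
  simp only [sub_zero, add_zero, Nat.succ_eq_add_one] at this ⊢
  linarith

lemma abs_sqrt_pi_div_stirlingSeq_sub_le {n : ℕ} (hn : n ≠ 0) :
    |√Real.pi / Stirling.stirlingSeq n - (1 - 1 / (12 * n) + 1 / (288 * (n : ℝ) ^ 2))| ≤
      1 / (n : ℝ) ^ 3 := by
  have hn' : (1 : ℝ) ≤ n := by exact_mod_cast Nat.one_le_iff_ne_zero.mpr hn
  have hπ : 0 < √Real.pi := by positivity
  have hs : 0 < Stirling.stirlingSeq n := hπ.trans_le (Stirling.sqrt_pi_le_stirlingSeq hn)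
  have hup := log_stirlingSeq_le hn
  have hlo := le_log_stirlingSeq hn
  obtain ⟨z, hz⟩ : ∃ z, z = Real.log √Real.pi - Real.log (Stirling.stirlingSeq n) := ⟨_, rfl⟩
  have hexp : √Real.pi / Stirling.stirlingSeq n = Real.exp z := by
    rw [hz, Real.exp_sub, Real.exp_log hπ, Real.exp_log hs]
  obtain ⟨x, hx⟩ : ∃ x : ℝ, x = 1 / n := ⟨_, rfl⟩
  have hx0 : 0 ≤ x := by rw [hx]; positivity
  have hx1 : x ≤ 1 := by rw [hx]; exact (div_le_one (by positivity)).mpr hn'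
  have e1 : 1 / (12 * (n : ℝ)) = x / 12 := by rw [hx]; field_simp
  have e2 : 1 / (288 * (n : ℝ) ^ 2) = x ^ 2 / 288 := by rw [hx]; field_simp
  have e3 : 1 / (144 * (n : ℝ) ^ 3) = x ^ 3 / 144 := by rw [hx]; field_simp
  have e4 : 1 / (n : ℝ) ^ 3 = x ^ 3 := by rw [hx]; field_simp
  rw [e1] at hup hlo
  rw [e3] at hlo
  rw [hexp, e1, e2, e4]
  have hz1 : -(x / 12) ≤ z := by linarith
  have hz2 : z ≤ -(x / 12) + x ^ 3 / 144 := by linarith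
  have hx3 : x ^ 3 ≤ x := by nlinarith [mul_nonneg hx0 hx0, mul_nonneg hx0 (sub_nonneg.2 hx1)]
  have hz0 : z ≤ 0 := by linarith
  have hmain := abs_exp_sub_taylor_two_le hz0
  have hcube : |z| ^ 3 ≤ (x / 12) ^ 3 := by
    gcongr
    rw [abs_of_nonpos hz0]
    linarith
  have hd : |(1 + z + z ^ 2 / 2) - (1 - x / 12 + x ^ 2 / 288)| ≤ x ^ 3 / 144 := by
    rw [show (1 + z + z ^ 2 / 2) - (1 - x / 12 + x ^ 2 / 288) =
      (z + x / 12) * (1 + (z - x / 12) / 2) by ring, abs_mul,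
      abs_of_nonneg (by linarith : 0 ≤ z + x / 12),
      abs_of_nonneg (by linarith : 0 ≤ 1 + (z - x / 12) / 2)]
    have h1 : z + x / 12 ≤ x ^ 3 / 144 := by linarith
    have h2 : 1 + (z - x / 12) / 2 ≤ 1 := by linarith
    calc _ ≤ (z + x / 12) * 1 := mul_le_mul_of_nonneg_left h2 (by linarith)
      _ ≤ _ := by linarith
  have := abs_sub_le (Real.exp z) (1 + z + z ^ 2 / 2) (1 - x / 12 + x ^ 2 / 288)
  have hx30 : 0 ≤ x ^ 3 := by positivity
  nlinarith

/-! ### Assembling the expansion -/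

lemma normalized_eq (α N : ℕ) (hα : 1 ≤ α) (hN : N ≠ 0) (P : ℝ) :
    Real.pi / √3 * (N : ℝ) ^ (α + 1) * (((N : ℝ) ^ (α - 1) * Real.exp 1) ^ N)⁻¹ * P =
      √((N : ℝ) / 6) / Stirling.stirlingSeq N *
        (Real.pi * (N.factorial * P) * ((N : ℝ) ^ α) / ((N : ℝ) ^ α) ^ N) := by
  have hn : (0 : ℝ) < N := by exact_mod_cast Nat.pos_of_ne_zero hN
  have hfac : (0 : ℝ) < N.factorial := by exact_mod_cast N.factorial_pos
  obtain ⟨β, rfl⟩ : ∃ β, α = β + 1 := ⟨α - 1, by omega⟩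
  have hsqrt : √((N : ℝ) / 6) * √(2 * (N : ℝ)) * √3 = N := by
    rw [← Real.sqrt_mul (by positivity), ← Real.sqrt_mul (by positivity),
      show (N : ℝ) / 6 * (2 * N) * 3 = (N : ℝ) ^ 2 by ring, Real.sqrt_sq hn.le]
  have h2 : √(2 * (N : ℝ)) ≠ 0 := by positivity
  have h3 : √(3 : ℝ) ≠ 0 := by positivity
  rw [Stirling.stirlingSeq, Nat.add_sub_cancel, div_pow, mul_pow, pow_succ (N : ℝ) β,
    mul_pow ((N : ℝ) ^ β)]
  generalize √((N : ℝ) / 6) = a at *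
  generalize √(2 * (N : ℝ)) = b at *
  generalize √(3 : ℝ) = c at *
  field_simp
  rw [pow_add, pow_add]
  linear_combination (-(N : ℝ) ^ β * N * P) * hsqrt

lemma exists_abs_normalized_sub_le {α : ℕ} (hα : 5 ≤ α) : ∃ C : ℝ, 0 ≤ C ∧ ∀ N : ℕ, 4 ≤ N →
    |Real.pi / √3 * (N : ℝ) ^ (α + 1) * (((N : ℝ) ^ (α - 1) * Real.exp 1) ^ N)⁻¹ *
        (magicHypercubeSeries α N : ℝ) -
      √Real.pi / Stirling.stirlingSeq N * (1 - 3 / (20 * N) - 13 / (1120 * (N : ℝ) ^ 2))| ≤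
      C / (N : ℝ) ^ 3 := by
  obtain ⟨C₁, hC₁0, hC₁⟩ := exists_abs_magicHypercubeSeries_sub_le
  obtain ⟨C₂, hC₂⟩ := exists_abs_integral_dirichletRatio_pow_sub_le
  refine ⟨2 * C₁ + |C₂|, by positivity, fun N hN => ?_⟩
  have hn4 : (4 : ℝ) ≤ N := by exact_mod_cast hN
  have hn : (0 : ℝ) < N := by linarith
  have hM : (0 : ℝ) < (N : ℝ) ^ α := by positivity
  have hM5 : (N : ℝ) ^ 5 ≤ (N : ℝ) ^ α := pow_le_pow_right₀ (by linarith) hα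
  have h₁ := hC₁ α N (by omega) hN
  have h₂ := hC₂ N ((N : ℝ) ^ α) (by omega) (pow_le_pow_right₀ (by linarith) (by omega))
  rw [normalized_eq α N (by omega) (by omega)]
  push_cast at h₁
  obtain ⟨J, hJ⟩ : ∃ J : ℝ, J = 1 - 3 / (20 * N) - 13 / (1120 * (N : ℝ) ^ 2) := ⟨_, rfl⟩
  rw [← hJ] at h₂ ⊢
  generalize (∫ u in (-(Real.pi * (N : ℝ) ^ α / 2))..(Real.pi * (N : ℝ) ^ α / 2),
    dirichletRatio ((N : ℝ) ^ α) u ^ N) = I at h₁ h₂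
  generalize Real.pi * (N.factorial * (magicHypercubeSeries α N : ℝ)) * (N : ℝ) ^ α = W at *
  have hs : √Real.pi ≤ Stirling.stirlingSeq N := Stirling.sqrt_pi_le_stirlingSeq (by omega)
  have hs1 : 1 ≤ Stirling.stirlingSeq N :=
    le_trans (Real.one_le_sqrt.mpr (by linarith [Real.pi_gt_three])) hs
  have hs0 : 0 < Stirling.stirlingSeq N := by linarith
  have hsqrtN : 0 < √(N : ℝ) := by positivity
  have hsqrt : √(N : ℝ) ≤ 2 * √((N - 2 : ℕ) : ℝ) := by
    have : ((N - 2 : ℕ) : ℝ) = N - 2 := by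
      push_cast [Nat.cast_sub (by omega : 2 ≤ N)]
      ring
    rw [this, ← Real.sqrt_sq (by norm_num : (0 : ℝ) ≤ 2), ← Real.sqrt_mul (by norm_num)]
    refine Real.sqrt_le_sqrt ?_
    rw [Real.sqrt_sq (by norm_num)]
    linarith
  have hW : |W / ((N : ℝ) ^ α) ^ N - I| ≤ 2 * C₁ / ((N : ℝ) ^ 3 * √N) := by
    have hMN : (0 : ℝ) < ((N : ℝ) ^ α) ^ N := by positivity
    rw [show W / ((N : ℝ) ^ α) ^ N - I = (W - ((N : ℝ) ^ α) ^ N * I) / ((N : ℝ) ^ α) ^ N by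
      field_simp, abs_div, abs_of_pos hMN]
    calc _ ≤ C₁ * (N : ℝ) ^ 2 * ((N : ℝ) ^ α) ^ (N - 1) / √((N - 2 : ℕ) : ℝ) /
          ((N : ℝ) ^ α) ^ N := by gcongr
      _ ≤ C₁ * (N : ℝ) ^ 2 * ((N : ℝ) ^ α) ^ (N - 1) / (√N / 2) / ((N : ℝ) ^ α) ^ N := by
        gcongr
        linarith
      _ = 2 * C₁ * (N : ℝ) ^ 2 / (√N * (N : ℝ) ^ α) := by
        have : ((N : ℝ) ^ α) ^ N = ((N : ℝ) ^ α) ^ (N - 1) * (N : ℝ) ^ α := by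
          rw [← pow_succ, show N - 1 + 1 = N by omega]
        rw [this]
        field_simp
      _ ≤ 2 * C₁ * (N : ℝ) ^ 2 / (√N * (N : ℝ) ^ 5) := by gcongr
      _ = _ := by field_simp
  have hC₂' : C₂ / ((N : ℝ) ^ 3 * √N) ≤ |C₂| / ((N : ℝ) ^ 3 * √N) := by
    gcongr
    exact le_abs_self _
  have htot : |W / ((N : ℝ) ^ α) ^ N - √(6 * Real.pi / N) * J| ≤
      (2 * C₁ + |C₂|) / ((N : ℝ) ^ 3 * √N) := by
    rw [add_div]
    exact (abs_sub_le _ I _).trans (add_le_add hW (h₂.trans hC₂'))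
  have hππ : √((N : ℝ) / 6) * √(6 * Real.pi / N) = √Real.pi := by
    rw [← Real.sqrt_mul (by positivity)]
    congr 1
    field_simp
  rw [← hππ, show ∀ a b w c J : ℝ, a / b * w - a * c / b * J = a / b * (w - c * J) by
    intros; ring, abs_mul, abs_of_nonneg (by positivity)]
  calc _ ≤ √(N : ℝ) / 1 * ((2 * C₁ + |C₂|) / ((N : ℝ) ^ 3 * √N)) := by
        gcongr
        linarith
    _ = _ := by field_simp

lemma abs_mul_expansion_sub_le {S n : ℝ} (hn : 1 ≤ n)
    (hS : |S - (1 - 1 / (12 * n) + 1 / (288 * n ^ 2))| ≤ 1 / n ^ 3) :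
    |S * (1 - 3 / (20 * n) - 13 / (1120 * n ^ 2)) -
      (1 - 7 / (30 * n) + 11 / (2520 * n ^ 2))| ≤ 2 / n ^ 3 := by
  obtain ⟨x, rfl⟩ : ∃ x : ℝ, n = 1 / x := ⟨1 / n, by field_simp⟩
  have hx0 : 0 < x := by
    by_contra! h
    have : 1 / x ≤ 0 := one_div_nonpos.mpr h
    linarith
  have hx1 : x ≤ 1 := (one_le_div hx0).mp hn
  have hlin : ∀ a b : ℝ, a / (b * (1 / x)) = a / b * x := fun a b => by field_simp
  have hsq : ∀ a b : ℝ, a / (b * (1 / x) ^ 2) = a / b * x ^ 2 := fun a b => by field_simp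
  have hcube : ∀ a : ℝ, a / (1 / x) ^ 3 = a * x ^ 3 := fun a => by field_simp
  simp only [hlin, hsq, hcube] at hS ⊢
  have hx3 : 0 < x ^ 3 := by positivity
  have hx2 : x ^ 2 ≤ 1 := pow_le_one₀ hx0.le hx1
  rw [show S * (1 - 3 / 20 * x - 13 / 1120 * x ^ 2) - (1 - 7 / 30 * x + 11 / 2520 * x ^ 2) =
    (S - (1 - 1 / 12 * x + 1 / 288 * x ^ 2)) * (1 - 3 / 20 * x - 13 / 1120 * x ^ 2) +
    (1 / 2240 - 13 / 322560 * x) * x ^ 3 by ring]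
  refine (abs_add_le _ _).trans ?_
  have hJ : |1 - 3 / 20 * x - 13 / 1120 * x ^ 2| ≤ 1 := by
    rw [abs_le]
    constructor <;> nlinarith
  have hK : |1 / 2240 - 13 / 322560 * x| ≤ 1 := by
    rw [abs_le]
    constructor <;> linarith
  rw [abs_mul, abs_mul, abs_of_pos hx3]
  nlinarith [mul_le_mul hS hJ (abs_nonneg _) (by positivity),
    abs_nonneg (1 / 2240 - 13 / 322560 * x)]

/-- Second-order asymptotic expansion for the number of `α`-dimensional hypercube
magic series (`α ≥ 5` fixed):
`𝒩_α(N) = (√3/π) (N^{α-1}e)^N / N^{α+1} (1 - 7/(30N) + 11/(2520N²) + O(1/N³))`,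
stated as
`(π/√3) N^{α+1} (N^{α-1}e)^{-N} 𝒩_α(N) - (1 - 7/(30N) + 11/(2520N²)) = O(1/N³)`. -/
theorem magic_hypercube_series_asymptotics (α : ℕ) (hα : 5 ≤ α) :
    (fun N : ℕ =>
        Real.pi / Real.sqrt 3 * (N : ℝ) ^ (α + 1) *
            (((N : ℝ) ^ (α - 1) * Real.exp 1) ^ N)⁻¹ * (magicHypercubeSeries α N : ℝ) -
          (1 - 7 / (30 * (N : ℝ)) + 11 / (2520 * (N : ℝ) ^ 2)))
      =O[atTop] fun N : ℕ => 1 / (N : ℝ) ^ 3 := by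
  obtain ⟨C, hC0, hC⟩ := exists_abs_normalized_sub_le hα
  refine IsBigO.of_bound (C + 2) ?_
  filter_upwards [eventually_ge_atTop 4] with N hN
  have hn : (1 : ℝ) ≤ N := by exact_mod_cast (by omega : 1 ≤ N)
  have h := hC N hN
  have h' := abs_mul_expansion_sub_le hn
    (abs_sqrt_pi_div_stirlingSeq_sub_le (by omega : N ≠ 0))
  rw [Real.norm_eq_abs, Real.norm_of_nonneg (by positivity), mul_one_div, add_div]
  exact (abs_sub_le _ _ _).trans (add_le_add h h')
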